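/- A bijection f : M → M of Minkowski space is a homeomorphism of (M, F), where F is the Fine topology, if and only if there exist a real number λ > 0, a linear map Λ : M → M satisfying q(Λ v) = q(v) for all v ∈ M, and a point a ∈ M, such that f(x) = a + λ • Λ x for all x ∈ M (i.e. the group of homeomorphisms of (M, F) is the group G generated by the Lorentz group, translations, and dilatations). -/

import Mathlib

noncomputable section

open TopologicalSpace Filter

/-- Minkowski space `M = ℝ × ℝ³`. -/
abbrev Mink : Type := ℝ × EuclideanSpace ℝ (Fin 3)

/-- The Euclidean (product) topology on `M`. -/
def TE : TopologicalSpace Mink := inferInstance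

/-- Time difference Δt(x,y). -/
def dtime (x y : Mink) : ℝ := y.1 - x.1

/-- Spatial distance Δr(x,y). -/
def dspace (x y : Mink) : ℝ := ‖y.2 - x.2‖

/-- Chronological order `x ≪ y`. -/
def Chron (x y : Mink) : Prop := dspace x y < dtime x y

/-- Causal order `x ≺ y`. -/
def Causal (x y : Mink) : Prop := dspace x y ≤ dtime x y

/-- Euclidean open ball of radius ε about x. -/
def eball (x : Mink) (ε : ℝ) : Set Mink :=
  {y | Real.sqrt ((y.1 - x.1) ^ 2 + ‖y.2 - x.2‖ ^ 2) < ε}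

/-- Time cone `C^T(x)`. -/
def timeCone (x : Mink) : Set Mink := {x} ∪ {y | Chron x y ∨ Chron y x}

/-- Space cone `C^S(x)`. -/
def spaceCone (x : Mink) : Set Mink := {x} ∪ {y | |dtime x y| < dspace x y}

/-- Light cone `C^L(x)`. -/
def lightCone (x : Mink) : Set Mink := {y | y ≠ x ∧ |dtime x y| = dspace x y}

/-- Causal cone `C^J(x)`. -/
def causalCone (x : Mink) : Set Mink := {x} ∪ {y | Causal x y ∨ Causal y x}

/-- Closed space cone `K^S(x)` (space cone together with the light cone). -/
def closedSpaceCone (x : Mink) : Set Mink := {x} ∪ {y | |dtime x y| ≤ dspace x y}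

/-- Bounded time cones, the defining family of `Z^T`. -/
def BasisT : Set (Set Mink) := {S | ∃ x ε, 0 < ε ∧ S = timeCone x ∩ eball x ε}

/-- Bounded space cones, the defining family of `Z^S`. -/
def BasisS : Set (Set Mink) := {S | ∃ x ε, 0 < ε ∧ S = spaceCone x ∩ eball x ε}

/-- Balls with the light cone of the centre removed, the defining family of `Z`. -/
def BasisZ : Set (Set Mink) := {S | ∃ x ε, 0 < ε ∧ S = eball x ε \ lightCone x}

/-- Zeeman's topology `Z^T` (the Minkowski analogue of the path topology). -/
def ZT : TopologicalSpace Mink := TopologicalSpace.generateFrom BasisT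

/-- The topology `Z^S`. -/
def ZS : TopologicalSpace Mink := TopologicalSpace.generateFrom BasisS

/-- The topology `Z`. -/
def Ztop : TopologicalSpace Mink := TopologicalSpace.generateFrom BasisZ

def Jplus (x : Mink) : Set Mink := {y | Causal x y}
def Jminus (x : Mink) : Set Mink := {y | Causal y x}
def Nplus (x : Mink) : Set Mink := {y | y ≠ x ∧ dtime x y = dspace x y}
def Nminus (x : Mink) : Set Mink := {y | y ≠ x ∧ -dtime x y = dspace x y}

/-- The interval topology `T^tc` whose subbasic open sets are time cones. -/
def Ttc : TopologicalSpace Mink :=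
  TopologicalSpace.generateFrom {S | ∃ x, S = timeCone x}

/-- The interval topology `T^≪` of the irreflexive causal order. -/
def Tll : TopologicalSpace Mink :=
  TopologicalSpace.generateFrom
    ({S | ∃ x, S = Set.univ \ (Jplus x \ {x})} ∪ {S | ∃ x, S = Set.univ \ (Jminus x \ {x})})

/-- The interval topology `T^→` of irreflexive horismos. -/
def Thor : TopologicalSpace Mink :=
  TopologicalSpace.generateFrom
    ({S | ∃ x, S = Set.univ \ Nplus x} ∪ {S | ∃ x, S = Set.univ \ Nminus x})

/-- The topology `(Z^T)′` generated by bounded causal cones. -/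
def ZT' : TopologicalSpace Mink :=
  TopologicalSpace.generateFrom {S | ∃ x ε, 0 < ε ∧ S = causalCone x ∩ eball x ε}

/-- The topology `(Z^S)′` generated by bounded closed space cones. -/
def ZS' : TopologicalSpace Mink :=
  TopologicalSpace.generateFrom {S | ∃ x ε, 0 < ε ∧ S = closedSpaceCone x ∩ eball x ε}

/-- The topology `(T^tc)′` generated by causal cones. -/
def Ttc' : TopologicalSpace Mink :=
  TopologicalSpace.generateFrom {S | ∃ x, S = causalCone x}

/-- The topology `(T^≪)′` generated by closed space cones. -/
def Tll' : TopologicalSpace Mink :=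
  TopologicalSpace.generateFrom {S | ∃ x, S = closedSpaceCone x}

/-- An endless causal curve. -/
def EndlessCausalCurve (γ : ℝ → Mink) : Prop :=
  Continuous γ ∧ (∀ s t : ℝ, s < t → Causal (γ s) (γ t) ∧ γ s ≠ γ t) ∧
    (∀ c : ℝ, ∃ t, c < (γ t).1) ∧ (∀ c : ℝ, ∃ t, (γ t).1 < c)

/-- `γ` is a `T`-limit curve of the sequence `γs` of curves. -/
def IsLimitCurve (T : TopologicalSpace Mink) (γ : ℝ → Mink) (γs : ℕ → ℝ → Mink) : Prop :=
  ∃ nk : ℕ → ℕ, StrictMono nk ∧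
    ∀ p ∈ Set.range γ, ∃ pk : ℕ → Mink,
      (∀ k, pk k ∈ Set.range (γs (nk k))) ∧ Filter.Tendsto pk Filter.atTop (@nhds Mink T p)

/-- The Minkowski quadratic form `q(v) = v₀² − ‖v⃗‖²`. -/
def qform (v : Mink) : ℝ := v.1 ^ 2 - ‖v.2‖ ^ 2

/-- `S` is a time axis: a line `{a + t • v}` with `v` timelike. -/
def IsTimeAxis (S : Set Mink) : Prop :=
  ∃ a v : Mink, ‖v.2‖ < |v.1| ∧ S = {p | ∃ t : ℝ, p = a + t • v}

/-- `S` is a space axis: an affine subspace `a + Λ({0} × ℝ³)` with `Λ` preserving `q`. -/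
def IsSpaceAxis (S : Set Mink) : Prop :=
  ∃ (a : Mink) (Λ : Mink →ₗ[ℝ] Mink), (∀ v, qform (Λ v) = qform v) ∧
    S = (fun w => a + Λ w) '' {v : Mink | v.1 = 0}

/-- `T` induces on every time axis and every space axis the same subspace topology
as the Euclidean topology. -/
def AxesProperty (T : TopologicalSpace Mink) : Prop :=
  ∀ S : Set Mink, IsTimeAxis S ∨ IsSpaceAxis S →
    TopologicalSpace.induced (Subtype.val : S → Mink) T =
      TopologicalSpace.induced (Subtype.val : S → Mink) TE

/-- Zeeman's Fine topology `F`: the finest topology inducing the Euclidean subspace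
topology on every time axis and on every space axis.  (In Mathlib's order on
topologies, finer means smaller, so this is the infimum.) -/
def Fine : TopologicalSpace Mink := sInf {T : TopologicalSpace Mink | AxesProperty T}

/-! ### Elementary Minkowski geometry -/

/-- The polar form of `qform`. -/
def mink (a b : Mink) : ℝ := a.1 * b.1 - inner ℝ a.2 b.2

theorem mink_self (a : Mink) : mink a a = qform a := by
  unfold mink qform
  rw [real_inner_self_eq_norm_sq]; ring

theorem mink_comm (a b : Mink) : mink a b = mink b a := by
  unfold mink
  rw [real_inner_comm]; ring

theorem mink_add_left (a b c : Mink) : mink (a + b) c = mink a c + mink b c := by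
  unfold mink
  simp only [Prod.fst_add, Prod.snd_add, inner_add_left]; ring

theorem mink_smul_left (r : ℝ) (a c : Mink) : mink (r • a) c = r * mink a c := by
  unfold mink
  simp only [Prod.smul_fst, Prod.smul_snd, real_inner_smul_left, smul_eq_mul]; ring

theorem mink_sub_left (a b c : Mink) : mink (a - b) c = mink a c - mink b c := by
  unfold mink
  simp only [Prod.fst_sub, Prod.snd_sub, inner_sub_left]; ring

theorem mink_add_right (a b c : Mink) : mink c (a + b) = mink c a + mink c b := by
  rw [mink_comm, mink_add_left, mink_comm a, mink_comm b]

theorem mink_sub_right (a b c : Mink) : mink c (a - b) = mink c a - mink c b := by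
  rw [mink_comm, mink_sub_left, mink_comm a, mink_comm b]

theorem mink_smul_right (r : ℝ) (a c : Mink) : mink c (r • a) = r * mink c a := by
  rw [mink_comm, mink_smul_left, mink_comm a]

theorem qform_add (a b : Mink) : qform (a + b) = qform a + 2 * mink a b + qform b := by
  simp only [← mink_self, mink_add_left, mink_add_right, mink_comm b a]; ring

theorem qform_sub (a b : Mink) : qform (a - b) = qform a - 2 * mink a b + qform b := by
  simp only [← mink_self, mink_sub_left, mink_sub_right, mink_comm b a]; ring

theorem qform_smul (r : ℝ) (a : Mink) : qform (r • a) = r ^ 2 * qform a := by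
  simp only [← mink_self, mink_smul_left, mink_smul_right]; ring

theorem qform_neg (a : Mink) : qform (-a) = qform a := by
  simp [qform]

theorem qform_sub_comm (a b : Mink) : qform (a - b) = qform (b - a) := by
  rw [← qform_neg, neg_sub]

theorem qform_continuous : Continuous qform := by
  unfold qform
  fun_prop

theorem qform_pos_iff (v : Mink) : 0 < qform v ↔ ‖v.2‖ < |v.1| := by
  unfold qform
  rw [sub_pos, sq_lt_sq, abs_of_nonneg (norm_nonneg v.2)]

theorem causal_iff (x y : Mink) : Causal x y ↔ ‖y.2 - x.2‖ ≤ y.1 - x.1 := Iff.rfl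

theorem chron_iff (x y : Mink) : Chron x y ↔ ‖y.2 - x.2‖ < y.1 - x.1 := Iff.rfl

theorem causal_refl (x : Mink) : Causal x x := by simp [causal_iff]

theorem norm_sub_tri (x y z : Mink) : ‖z.2 - x.2‖ ≤ ‖y.2 - x.2‖ + ‖z.2 - y.2‖ := by
  have h : z.2 - x.2 = (y.2 - x.2) + (z.2 - y.2) := by abel
  rw [h]; exact norm_add_le _ _

theorem causal_trans {x y z : Mink} (h1 : Causal x y) (h2 : Causal y z) : Causal x z := by
  rw [causal_iff] at *
  linarith [norm_sub_tri x y z]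

theorem chron_causal {x y z : Mink} (h1 : Chron x y) (h2 : Causal y z) : Chron x z := by
  rw [causal_iff] at *
  rw [chron_iff] at *
  linarith [norm_sub_tri x y z]

theorem causal_chron {x y z : Mink} (h1 : Causal x y) (h2 : Chron y z) : Chron x z := by
  rw [causal_iff] at *
  rw [chron_iff] at *
  linarith [norm_sub_tri x y z]

theorem Chron.causal {x y : Mink} (h : Chron x y) : Causal x y := le_of_lt h

theorem chron_irrefl (x : Mink) : ¬ Chron x x := by simp [chron_iff]

theorem causal_antisymm {x y : Mink} (h1 : Causal x y) (h2 : Causal y x) : x = y := by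
  rw [causal_iff] at *
  have a1 := norm_nonneg (y.2 - x.2)
  have a2 := norm_nonneg (x.2 - y.2)
  have e : ‖y.2 - x.2‖ = 0 := by linarith
  have e1 : y.1 = x.1 := by linarith
  rw [norm_eq_zero, sub_eq_zero] at e
  exact Prod.ext e1.symm e.symm

theorem chron_fst {x y : Mink} (h : Chron x y) : x.1 < y.1 := by
  rw [chron_iff] at h
  linarith [norm_nonneg (y.2 - x.2)]

theorem causal_lim {ι : Type*} {l : Filter ι} [l.NeBot] {u v : ι → Mink} {a b : Mink}
    (hu : Tendsto u l (nhds a)) (hv : Tendsto v l (nhds b))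
    (h : ∀ᶠ i in l, Causal (u i) (v i)) : Causal a b := by
  rw [causal_iff]
  have u1 := (continuous_fst.tendsto a).comp hu
  have u2 := (continuous_snd.tendsto a).comp hu
  have v1 := (continuous_fst.tendsto b).comp hv
  have v2 := (continuous_snd.tendsto b).comp hv
  exact le_of_tendsto_of_tendsto (v2.sub u2).norm (v1.sub u1) h

theorem isClosed_causal {X : Type*} [TopologicalSpace X] {u v : X → Mink} (hu : Continuous u)
    (hv : Continuous v) : IsClosed {x | Causal (u x) (v x)} := by
  simp only [causal_iff]
  exact isClosed_le (by fun_prop) (by fun_prop)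

theorem qform_pos_chron (x y : Mink) : 0 < qform (y - x) ↔ Chron x y ∨ Chron y x := by
  rw [qform_pos_iff, lt_abs, chron_iff, chron_iff, norm_sub_rev x.2 y.2]
  simp

theorem qform_nonneg_causal (x y : Mink) : 0 ≤ qform (y - x) ↔ Causal x y ∨ Causal y x := by
  unfold qform
  rw [sub_nonneg, sq_le_sq, abs_of_nonneg (norm_nonneg _), le_abs, causal_iff, causal_iff,
    norm_sub_rev x.2 y.2]
  simp

/-- Time reversal. -/
def theta (x : Mink) : Mink := (-x.1, x.2)

theorem theta_theta (x : Mink) : theta (theta x) = x := by simp [theta]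

theorem theta_continuous : Continuous theta := by
  unfold theta; fun_prop

theorem theta_inj {x y : Mink} (h : theta x = theta y) : x = y := by
  rw [← theta_theta x, h, theta_theta]

theorem causal_theta (x y : Mink) : Causal (theta x) (theta y) ↔ Causal y x := by
  simp only [causal_iff, theta]
  rw [norm_sub_rev, neg_sub_neg]

theorem chron_theta (x y : Mink) : Chron (theta x) (theta y) ↔ Chron y x := by
  simp only [chron_iff, theta]
  rw [norm_sub_rev, neg_sub_neg]

theorem qform_theta_sub (x y : Mink) : qform (theta x - theta y) = qform (x - y) := by
  simp only [theta, qform, Prod.fst_sub, Prod.snd_sub]; ring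

/-! ### Axes and the fine topology -/

def IsAxis (S : Set Mink) : Prop := IsTimeAxis S ∨ IsSpaceAxis S

/-- Working description of the open sets of the fine topology. -/
def FO (U : Set Mink) : Prop := ∀ S : Set Mink, IsAxis S → IsOpen (Subtype.val ⁻¹' U : Set S)

/-- The final topology with respect to the axes. -/
def FT : TopologicalSpace Mink where
  IsOpen := FO
  isOpen_univ := fun S _ => by simp
  isOpen_inter := fun U V hU hV S hS => by
    rw [Set.preimage_inter]; exact (hU S hS).inter (hV S hS)
  isOpen_sUnion := fun C hC S hS => by
    rw [Set.preimage_sUnion]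
    exact isOpen_biUnion fun U hU => hC U hU S hS

theorem FO_of_isOpen {U : Set Mink} (hU : IsOpen U) : FO U :=
  fun _ _ => hU.preimage continuous_subtype_val

theorem Fine_eq_FT : Fine = FT := by
  apply le_antisymm
  · apply sInf_le
    intro S hS
    apply le_antisymm
    · apply induced_mono
      intro U hU
      exact FO_of_isOpen hU
    · intro W hW
      obtain ⟨U, hU, rfl⟩ := hW
      exact hU S hS
  · apply le_sInf
    intro T hT U hU S hS
    have h := hT S hS
    have : @IsOpen _ (TopologicalSpace.induced (Subtype.val : S → Mink) T) (Subtype.val ⁻¹' U) :=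
      ⟨U, hU, rfl⟩
    rw [h] at this
    exact this

theorem fine_isOpen_iff (U : Set Mink) : @IsOpen Mink Fine U ↔ FO U := by
  rw [Fine_eq_FT]; exact Iff.rfl

/-- Continuity from the fine to the fine topology. -/
def FC (f : Mink → Mink) : Prop := ∀ U, FO U → FO (f ⁻¹' U)

/-- Continuity from a space into the fine topology. -/
def FCt {X : Type*} [TopologicalSpace X] (h : X → Mink) : Prop := ∀ U, FO U → IsOpen (h ⁻¹' U)

theorem FCt.continuous {X : Type*} [TopologicalSpace X] {h : X → Mink} (hh : FCt h) :
    Continuous h := ⟨fun U hU => hh U (FO_of_isOpen hU)⟩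

theorem FCt.comp {X : Type*} [TopologicalSpace X] {h : X → Mink} (hh : FCt h) {f : Mink → Mink}
    (hf : FC f) : FCt (fun x => f (h x)) := fun U hU => hh _ (hf U hU)

theorem FCt_of_axis {X : Type*} [TopologicalSpace X] {h : X → Mink} (hh : Continuous h)
    {S : Set Mink} (hS : IsAxis S) (hm : ∀ x, h x ∈ S) : FCt h := by
  intro U hU
  have := (hU S hS).preimage (hh.subtype_mk hm)
  exact this

theorem FC_of_FCt {f : Mink → Mink} (hf : ∀ S, IsAxis S → FCt (fun x : S => f x)) : FC f :=
  fun U hU S hS => hf S hS U hU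

theorem isTimeAxis_line (a v : Mink) (hv : 0 < qform v) :
    IsTimeAxis {p | ∃ t : ℝ, p = a + t • v} := ⟨a, v, (qform_pos_iff v).1 hv, rfl⟩

theorem FCt_line (a v : Mink) (hv : 0 < qform v) : FCt (fun t : ℝ => a + t • v) :=
  FCt_of_axis (by fun_prop) (Or.inl (isTimeAxis_line a v hv)) fun t => ⟨t, rfl⟩

theorem FCt_space (a : Mink) (Λ : Mink →ₗ[ℝ] Mink) (hΛ : ∀ v, qform (Λ v) = qform v) :
    FCt (fun y : EuclideanSpace ℝ (Fin 3) => a + Λ (0, y)) := by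
  refine FCt_of_axis (S := (fun w => a + Λ w) '' {v : Mink | v.1 = 0}) ?_
    (Or.inr ⟨a, Λ, hΛ, rfl⟩) fun y => ⟨(0, y), rfl, rfl⟩
  have : Continuous Λ := Λ.continuous_of_finiteDimensional
  fun_prop

theorem FCt_slice (a : Mink) :
    FCt (fun y : EuclideanSpace ℝ (Fin 3) => a + ((0 : ℝ), y)) :=
  FCt_space a LinearMap.id fun _ => rfl

theorem timeAxis_pos {S : Set Mink} (hS : IsTimeAxis S) {x y : Mink} (hx : x ∈ S) (hy : y ∈ S)
    (hxy : y ≠ x) : 0 < qform (y - x) := by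
  obtain ⟨a, v, hv, rfl⟩ := hS
  obtain ⟨s, rfl⟩ := hx
  obtain ⟨t, rfl⟩ := hy
  have e : a + t • v - (a + s • v) = (t - s) • v := by rw [sub_smul]; abel
  rw [e, qform_smul]
  have hts : t - s ≠ 0 := by
    intro h
    apply hxy
    rw [sub_eq_zero.1 h]
  exact mul_pos (by positivity) ((qform_pos_iff v).2 hv)

theorem spaceAxis_neg {S : Set Mink} (hS : IsSpaceAxis S) {x y : Mink} (hx : x ∈ S) (hy : y ∈ S)
    (hxy : y ≠ x) : qform (y - x) < 0 := by
  obtain ⟨a, Λ, hΛ, rfl⟩ := hS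
  obtain ⟨s, hs, rfl⟩ := hx
  obtain ⟨t, ht, rfl⟩ := hy
  have e : a + Λ t - (a + Λ s) = Λ (t - s) := by rw [map_sub]; abel
  simp only [Set.mem_ofPred_eq] at hs ht
  simp only [e, hΛ]
  have hts : t.2 - s.2 ≠ 0 := by
    intro h
    apply hxy
    have : t = s := Prod.ext (by rw [hs, ht]) (sub_eq_zero.1 h)
    rw [this]
  unfold qform
  have := norm_pos_iff.2 hts
  simp only [Prod.fst_sub, Prod.snd_sub, hs, ht]
  nlinarith

theorem FO_compl {C : Set Mink} {x : Mink} (hC : IsClosed (insert x C))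
    (h : ∀ S, IsAxis S → x ∈ S → IsClosed (C ∩ S)) : FO Cᶜ := by
  intro S hS
  by_cases hx : x ∈ S
  · have : (Subtype.val ⁻¹' Cᶜ : Set S) = Subtype.val ⁻¹' (C ∩ S)ᶜ := by
      ext y; simp
    rw [this]
    exact (h S hS hx).isOpen_compl.preimage continuous_subtype_val
  · have : (Subtype.val ⁻¹' Cᶜ : Set S) = Subtype.val ⁻¹' (insert x C)ᶜ := by
      ext y
      have : (y : Mink) ≠ x := fun h => hx (h ▸ y.2)
      simp [this]
    rw [this]
    exact hC.isOpen_compl.preimage continuous_subtype_val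

theorem FO_lightCone (x : Mink) : FO {y | y ≠ x ∧ qform (y - x) = 0}ᶜ := by
  apply FO_compl (x := x)
  · have : insert x {y | y ≠ x ∧ qform (y - x) = 0} = {y | qform (y - x) = 0} := by
      ext y
      by_cases h : y = x
      · simp [h, qform]
      · simp [h]
    rw [this]
    exact isClosed_eq (qform_continuous.comp (by fun_prop)) continuous_const
  · intro S hS hx
    have : {y | y ≠ x ∧ qform (y - x) = 0} ∩ S = ∅ := by
      ext y
      simp only [Set.mem_inter_iff, Set.mem_ofPred_eq, Set.mem_empty_iff_false, iff_false]
      rintro ⟨⟨h1, h2⟩, h3⟩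
      rcases hS with hS | hS
      · exact (timeAxis_pos hS hx h3 h1).ne' h2
      · exact (spaceAxis_neg hS hx h3 h1).ne h2
    rw [this]; exact isClosed_empty

/-- A sequence converging to `x` in the fine topology returns infinitely often to some axis
through `x`. -/
theorem zeno {z : ℕ → Mink} {x : Mink} (hz : ∀ U, FO U → x ∈ U → ∀ᶠ k in atTop, z k ∈ U)
    (hne : ∀ k, z k ≠ x) : ∃ S, IsAxis S ∧ x ∈ S ∧ ∃ᶠ k in atTop, z k ∈ S := by
  by_contra hcon
  push Not at hcon
  have hE : Tendsto z atTop (nhds x) := by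
    rw [tendsto_nhds]
    intro U hU hx
    exact hz U (FO_of_isOpen hU) hx
  have hO : FO (Set.range z)ᶜ := by
    apply FO_compl (x := x)
    · exact hE.isCompact_insert_range.isClosed
    · intro S hS hx
      have h := hcon S hS hx
      obtain ⟨N, hN⟩ := eventually_atTop.1 h
      apply Set.Finite.isClosed
      apply Set.Finite.subset ((Set.finite_lt_nat N).image z)
      rintro _ ⟨⟨k, rfl⟩, hk⟩
      refine ⟨k, ?_, rfl⟩
      by_contra hkN
      exact hN k (not_lt.1 hkN) hk
  have := hz _ hO (by
    rintro ⟨k, hk⟩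
    exact hne k hk)
  obtain ⟨k, hk⟩ := this.exists
  exact hk ⟨k, rfl⟩
/-! ### Constant velocity -/

def vel (v : Mink) : EuclideanSpace ℝ (Fin 3) := v.1⁻¹ • v.2

theorem vel_smul {r : ℝ} (hr : r ≠ 0) (v : Mink) : vel (r • v) = vel v := by
  unfold vel
  simp only [Prod.smul_fst, Prod.smul_snd, smul_eq_mul, smul_smul]
  congr 1
  field_simp

theorem fst_ne_zero_of_qform_pos {v : Mink} (hv : 0 < qform v) : v.1 ≠ 0 := by
  intro h
  unfold qform at hv
  rw [h] at hv
  nlinarith [sq_nonneg ‖v.2‖]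

theorem eq_smul_vel {v : Mink} (hv : 0 < qform v) : v = v.1 • ((1 : ℝ), vel v) := by
  have := fst_ne_zero_of_qform_pos hv
  unfold vel
  ext1
  · simp
  · simp [smul_smul, this]

theorem norm_vel_lt {v : Mink} (hv : 0 < qform v) : ‖vel v‖ < 1 := by
  have h := (qform_pos_iff v).1 hv
  have := fst_ne_zero_of_qform_pos hv
  unfold vel
  rw [norm_smul, norm_inv, Real.norm_eq_abs, inv_mul_lt_iff₀ (abs_pos.2 this)]
  simpa using h

theorem timeAxis_vel {S : Set Mink} (hS : IsTimeAxis S) {x y z : Mink} (hx : x ∈ S) (hy : y ∈ S)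
    (hz : z ∈ S) (hxy : y ≠ x) (hxz : z ≠ x) : vel (y - x) = vel (z - x) := by
  obtain ⟨a, v, hv, rfl⟩ := hS
  obtain ⟨s, rfl⟩ := hx
  obtain ⟨t, rfl⟩ := hy
  obtain ⟨u, rfl⟩ := hz
  have e : ∀ t : ℝ, a + t • v - (a + s • v) = (t - s) • v := fun t => by rw [sub_smul]; abel
  have hts : t - s ≠ 0 := by
    intro h
    apply hxy
    rw [sub_eq_zero.1 h]
  have hus : u - s ≠ 0 := by
    intro h
    apply hxz
    rw [sub_eq_zero.1 h]
  rw [e, e, vel_smul hts, vel_smul hus]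

theorem const_vel {X : Type*} [TopologicalSpace X] {P : ℕ → Set X} (hanti : Antitone P)
    (hpc : ∀ k, IsPreconnected (P k)) {h : X → Mink} {x0 : Mink} (hc : ContinuousOn h (P 0))
    (hq : ∀ b ∈ P 0, 0 < qform (h b - x0))
    (hU : ∀ U, FO U → x0 ∈ U → ∃ k, ∀ b ∈ P k, h b ∈ U) :
    ∃ k, ∀ b ∈ P k, ∀ b' ∈ P k, vel (h b - x0) = vel (h b' - x0) := by
  by_contra hcon
  push Not at hcon
  have hcv : ContinuousOn (fun b => vel (h b - x0)) (P 0) := by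
    unfold vel
    apply ContinuousOn.fun_smul
    · apply ContinuousOn.fun_inv₀
      · exact (continuous_fst.comp_continuousOn (hc.sub continuousOn_const))
      · intro b hb
        exact fst_ne_zero_of_qform_pos (hq b hb)
    · exact (continuous_snd.comp_continuousOn (hc.sub continuousOn_const))
  have hinf : ∀ k, ((fun b => vel (h b - x0)) '' (P k)).Infinite := by
    intro k
    apply IsPreconnected.infinite_of_nontrivial
    · exact (hpc k).image _ (hcv.mono (hanti (Nat.zero_le k)))
    · obtain ⟨b, hb, b', hb', hne⟩ := hcon k
      exact ⟨_, ⟨b, hb, rfl⟩, _, ⟨b', hb', rfl⟩, hne⟩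
  obtain ⟨f, hf1, hf2⟩ := exists_seq_of_forall_finset_exists
    (fun p : ℕ × X => p.2 ∈ P p.1)
    (fun p p' => p.1 < p'.1 ∧ vel (h p.2 - x0) ≠ vel (h p'.2 - x0)) (by
      intro s hs
      classical
      obtain ⟨K, hK⟩ : ∃ K : ℕ, ∀ p ∈ s, p.1 < K :=
        ⟨s.sup Prod.fst + 1, fun p hp => Nat.lt_succ_of_le (Finset.le_sup (f := Prod.fst) hp)⟩
      obtain ⟨_, ⟨b, hb, rfl⟩, hb2⟩ := (hinf K).exists_notMem_finset
        (s.image (fun p => vel (h p.2 - x0)))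
      refine ⟨(K, b), hb, fun p hp => ⟨hK p hp, fun he => hb2 ?_⟩⟩
      rw [Finset.mem_image]
      exact ⟨p, hp, he⟩)
  have hmono : StrictMono (fun n => (f n).1) := fun m n hmn => (hf2 m n hmn).1
  have hP0 : ∀ n, (f n).2 ∈ P 0 := fun n => hanti (Nat.zero_le _) (hf1 n)
  have hne : ∀ n, h (f n).2 ≠ x0 := by
    intro n he
    have := hq _ (hP0 n)
    rw [he] at this
    simp [qform] at this
  obtain ⟨S, hS, hxS, hfr⟩ := zeno (z := fun n => h (f n).2) (x := x0) (by
    intro U hU1 hx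
    obtain ⟨k, hk⟩ := hU U hU1 hx
    filter_upwards [eventually_ge_atTop k] with n hn
    exact hk _ (hanti (hn.trans (hmono.id_le n)) (hf1 n))) hne
  obtain ⟨m, hm⟩ := hfr.exists
  obtain ⟨n, hn, hn2⟩ := (hfr.and_eventually (eventually_gt_atTop m)).exists
  rcases hS with hS | hS
  · exact (hf2 m n hn2).2 (timeAxis_vel hS hxS hm hn (hne m) (hne n))
  · exact absurd (hq _ (hP0 m)) (not_lt.2 (spaceAxis_neg hS hxS hm (hne m)).le)

/-- Same velocity and same time coordinate implies equality. -/
theorem eq_of_vel {x0 y z : Mink} (hy : 0 < qform (y - x0)) (hz : 0 < qform (z - x0))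
    (hv : vel (y - x0) = vel (z - x0)) (h1 : y.1 = z.1) : y = z := by
  have e1 := eq_smul_vel hy
  have e2 := eq_smul_vel hz
  have : y - x0 = z - x0 := by
    rw [e1, e2, hv]
    simp [h1]
  simpa using this

abbrev E3 : Type := EuclideanSpace ℝ (Fin 3)

theorem rank_E3 : 1 < Module.rank ℝ E3 := by
  rw [← Module.finrank_eq_rank]
  simp

/-- The punctured ball. -/
def pball (δ : ℝ) : Set E3 := {b | 0 < ‖b‖ ∧ ‖b‖ < δ}

theorem pball_preconnected (δ : ℝ) : IsPreconnected (pball δ) := by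
  have : pball δ = (fun p : ℝ × E3 => p.1 • p.2) '' (Set.Ioo 0 δ ×ˢ Metric.sphere 0 1) := by
    ext b
    constructor
    · rintro ⟨h1, h2⟩
      refine ⟨(‖b‖, ‖b‖⁻¹ • b), ⟨⟨h1, h2⟩, ?_⟩, ?_⟩
      · simp [norm_smul, h1.ne']
      · simp [smul_smul, h1.ne']
    · rintro ⟨⟨r, y⟩, ⟨⟨h1, h2⟩, h3⟩, rfl⟩
      simp only [mem_sphere_iff_norm, sub_zero] at h1 h2 h3
      simp only [pball, Set.mem_ofPred_eq, norm_smul, h3, Real.norm_eq_abs, abs_of_pos h1, mul_one]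
      exact ⟨h1, h2⟩
  rw [this]
  exact (isPreconnected_Ioo.prod (isPreconnected_sphere rank_E3 0 1)).image _ (by fun_prop)

theorem pball_sub {δ δ' : ℝ} (h : δ ≤ δ') : pball δ ⊆ pball δ' := fun _ hb => ⟨hb.1, hb.2.trans_le h⟩

theorem neg_const_sign {X : Type*} [TopologicalSpace X] {P : Set X} (hP : IsPreconnected P)
    {g : X → ℝ} (hg : ContinuousOn g P) (h0 : ∀ b ∈ P, g b ≠ 0) :
    (∀ b ∈ P, 0 < g b) ∨ (∀ b ∈ P, g b < 0) := by
  by_contra hcon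
  push Not at hcon
  obtain ⟨⟨a, ha, ha2⟩, ⟨b, hb, hb2⟩⟩ := hcon
  obtain ⟨c, hc, hc2⟩ := hP.intermediate_value ha hb hg ⟨ha2, hb2⟩
  exact h0 c hc hc2

theorem L1 {h : E3 → Mink} (hh : FCt h) (hinj : Function.Injective h) :
    ∃ δ > 0, ∀ b, 0 < ‖b‖ → ‖b‖ < δ → qform (h b - h 0) < 0 := by
  have key : ∀ U, FO U → h 0 ∈ U → ∃ δ > 0, ∀ b, ‖b‖ < δ → h b ∈ U := by
    intro U hU h0
    obtain ⟨δ, hδ, hb⟩ := Metric.isOpen_iff.1 (hh U hU) 0 h0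
    exact ⟨δ, hδ, fun b hb' => hb (by simpa using hb')⟩
  obtain ⟨δ, hδ, hL⟩ := key _ (FO_lightCone (h 0)) (by simp)
  have hne : ∀ b, 0 < ‖b‖ → h b ≠ h 0 := by
    intro b hb he
    rw [hinj he] at hb
    simp at hb
  have hcont := hh.continuous
  rcases neg_const_sign (pball_preconnected δ) (g := fun b => qform (h b - h 0))
    ((qform_continuous.comp (by fun_prop)).continuousOn) (by
      intro b hb he
      exact hL b hb.2 ⟨hne b hb.1, he⟩) with hpos | hneg
  · exfalso
    obtain ⟨k, hk⟩ := const_vel (P := fun k : ℕ => pball (δ / (k + 1))) (h := h) (x0 := h 0) (by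
        intro k l hkl
        apply pball_sub
        have : (k : ℝ) ≤ l := by exact_mod_cast hkl
        gcongr) (fun k => pball_preconnected _) hcont.continuousOn (by
        intro b hb
        exact hpos b (by simpa using hb)) (by
        intro U hU h0
        obtain ⟨δ', hδ', hb⟩ := key U hU h0
        obtain ⟨k, hk⟩ := exists_nat_gt (δ / δ')
        refine ⟨k, fun b hb2 => hb b (hb2.2.trans_le ?_)⟩
        rw [div_lt_iff₀ hδ'] at hk
        rw [div_le_iff₀ (by positivity)]
        nlinarith)
    set ε := δ / (k + 1) with hε
    have hε0 : 0 < ε := by positivity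
    have hεδ : ε ≤ δ := by
      rw [hε]
      apply div_le_self hδ.le
      linarith [Nat.cast_nonneg (α := ℝ) k]
    obtain ⟨b0, hb0⟩ : (pball ε).Nonempty := by
      refine ⟨EuclideanSpace.single 0 (ε / 2), ?_, ?_⟩
      · simp [hε0.ne']
      · simp [abs_of_pos hε0, hε0]
    have hneg : ∀ b ∈ pball ε, -b ∈ pball ε := fun b hb => by simpa [pball] using hb
    rcases neg_const_sign (pball_preconnected ε) (g := fun b => (h b).1 - (h (-b)).1)
      (by fun_prop) (by
        intro b hb he
        have := eq_of_vel (hpos b (pball_sub hεδ hb)) (hpos _ (pball_sub hεδ (hneg b hb)))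
          (hk b hb _ (hneg b hb)) (by linarith)
        have := hinj this
        have h2 : b = 0 := by
          rw [eq_neg_iff_add_eq_zero, ← two_smul ℝ] at this
          simpa using this
        rw [h2] at hb
        exact absurd hb.1 (by simp)) with h1 | h1
    · have a1 := h1 b0 hb0
      have a2 := h1 _ (hneg b0 hb0)
      simp only [neg_neg] at a2
      linarith
    · have a1 := h1 b0 hb0
      have a2 := h1 _ (hneg b0 hb0)
      simp only [neg_neg] at a2
      linarith
  · exact ⟨δ, hδ, fun b h1 h2 => hneg b ⟨h1, h2⟩⟩
/-! ### Germs along timelike lines -/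

theorem lorentz_injective {Λ : Mink →ₗ[ℝ] Mink} (hΛ : ∀ v, qform (Λ v) = qform v) :
    Function.Injective Λ := by
  rw [← LinearMap.ker_eq_bot, LinearMap.ker_eq_bot']
  intro v hv
  have h1 : qform (v + theta v) = qform (theta v) := by
    rw [← hΛ, map_add, hv, zero_add, hΛ]
  have h0 : qform v = 0 := by
    rw [← hΛ, hv]; simp [qform]
  rw [qform_add, h0] at h1
  have h2 : mink v (theta v) = 0 := by linarith
  simp only [mink, theta, real_inner_self_eq_norm_sq] at h2
  have h3 : v.1 = 0 := by nlinarith [sq_nonneg v.1, sq_nonneg ‖v.2‖]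
  have h4 : ‖v.2‖ = 0 := by nlinarith [sq_nonneg v.1, sq_nonneg ‖v.2‖]
  exact Prod.ext h3 (norm_eq_zero.1 h4)

/-- Homeomorphisms of the fine topology. -/
def FH (e : Mink ≃ Mink) : Prop := FC e ∧ FC e.symm

theorem chron_line {c : E3} (hc : ‖c‖ < 1) (x : Mink) {a b : ℝ} (hab : a < b) :
    Chron (x + a • ((1 : ℝ), c)) (x + b • ((1 : ℝ), c)) := by
  rw [chron_iff]
  have : (x + b • ((1 : ℝ), c)).2 - (x + a • ((1 : ℝ), c)).2 = (b - a) • c := by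
    simp [sub_smul]
  rw [this, norm_smul, Real.norm_eq_abs, abs_of_pos (by linarith)]
  simp
  nlinarith

theorem qform_one_pos {c : E3} (hc : ‖c‖ < 1) : 0 < qform ((1 : ℝ), c) := by
  unfold qform
  simp
  exact hc

theorem L2 {e : Mink ≃ Mink} (he : FH e) (x : Mink) {v : Mink} (hv : 0 < qform v) :
    ∃ δ > 0, ∃ (c : E3) (ρ : ℝ → ℝ), ‖c‖ < 1 ∧
      (∀ s ∈ Set.Icc 0 δ, e (x + s • v) = e x + ρ s • ((1 : ℝ), c)) ∧ ρ 0 = 0 ∧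
      ContinuousOn ρ (Set.Icc 0 δ) ∧
      (StrictMonoOn ρ (Set.Icc 0 δ) ∨ StrictAntiOn ρ (Set.Icc 0 δ)) := by
  set γ : ℝ → Mink := fun s => e (x + s • v) with hγ
  have hγF : FCt γ := (FCt_line x v hv).comp he.1
  have hγ0 : γ 0 = e x := by simp [hγ]
  have hv0 : v ≠ 0 := by
    rintro rfl
    simp [qform] at hv
  have hinj : Function.Injective γ := by
    intro s t hst
    have := e.injective hst
    simp only [add_right_inj] at this
    exact smul_left_injective ℝ hv0 this
  have hcont := hγF.continuous
  have key : ∀ U, FO U → e x ∈ U → ∃ δ > 0, ∀ s, |s| < δ → γ s ∈ U := by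
    intro U hU h0
    rw [← hγ0] at h0
    obtain ⟨δ, hδ, hb⟩ := Metric.isOpen_iff.1 (hγF U hU) 0 h0
    exact ⟨δ, hδ, fun b hb' => hb (by simpa using hb')⟩
  have hne : ∀ s, s ≠ 0 → γ s ≠ e x := by
    intro s hs h
    rw [← hγ0] at h
    exact hs (hinj h)
  obtain ⟨δ, hδ, hL⟩ := key _ (FO_lightCone (e x)) (by simp)
  rcases neg_const_sign (isPreconnected_Ioo (a := (0 : ℝ)) (b := δ))
    (g := fun b => qform (γ b - e x))
    ((qform_continuous.comp (by fun_prop)).continuousOn) (by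
      intro b hb he
      exact hL b (by rw [abs_of_pos hb.1]; exact hb.2) ⟨hne b hb.1.ne', he⟩) with hpos | hneg
  · obtain ⟨k, hk⟩ := const_vel (P := fun k : ℕ => Set.Ioo 0 (δ / (k + 1))) (h := γ)
      (x0 := e x) (by
        intro k l hkl
        apply Set.Ioo_subset_Ioo_right
        have : (k : ℝ) ≤ l := by exact_mod_cast hkl
        gcongr) (fun k => isPreconnected_Ioo) hcont.continuousOn (by
        intro b hb
        exact hpos b (by simpa using hb)) (by
        intro U hU h0
        obtain ⟨δ', hδ', hb⟩ := key U hU h0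
        obtain ⟨k, hk⟩ := exists_nat_gt (δ / δ')
        refine ⟨k, fun b hb2 => hb b ?_⟩
        rw [abs_of_pos hb2.1]
        refine hb2.2.trans_le ?_
        rw [div_lt_iff₀ hδ'] at hk
        rw [div_le_iff₀ (by positivity)]
        nlinarith)
    set ε := δ / (k + 1) with hε
    have hε0 : 0 < ε := by positivity
    have hεδ : ε ≤ δ := by
      rw [hε]
      apply div_le_self hδ.le
      linarith [Nat.cast_nonneg (α := ℝ) k]
    have hmem : ε / 2 ∈ Set.Ioo 0 ε := ⟨by linarith, by linarith⟩
    have hform : ∀ s ∈ Set.Icc 0 (ε / 2), γ s = e x + ((γ s).1 - (e x).1) •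
        ((1 : ℝ), vel (γ (ε / 2) - e x)) := by
      intro s hs
      rcases eq_or_lt_of_le hs.1 with h | h
      · rw [← h, hγ0]; simp
      · have hs2 : s ∈ Set.Ioo 0 ε := ⟨h, by linarith [hs.2]⟩
        have := eq_smul_vel (hpos s ⟨h, by linarith [hs.2]⟩)
        rw [hk s hs2 _ hmem] at this
        rw [← Prod.fst_sub, ← this]; abel
    refine ⟨ε / 2, by linarith, vel (γ (ε / 2) - e x), fun s => (γ s).1 - (e x).1, ?_, hform, ?_,
      by fun_prop, ?_⟩
    · exact norm_vel_lt (hpos _ ⟨by linarith, by linarith⟩)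
    · simp [hγ0]
    · apply ContinuousOn.strictMonoOn_of_injOn_Icc'
      · linarith
      · fun_prop
      · intro s hs t ht hst
        apply hinj
        rw [hform s hs, hform t ht]
        simp only at hst
        rw [hst]
  · exfalso
    set sk : ℕ → ℝ := fun k => δ / (k + 2) with hsk
    have hsk0 : ∀ k, 0 < sk k := fun k => by simp only [hsk]; positivity
    have hsk1 : ∀ k, sk k < δ := fun k => by
      simp only [hsk]
      rw [div_lt_iff₀ (by positivity)]
      nlinarith [Nat.cast_nonneg (α := ℝ) k]
    have hlim : Tendsto sk atTop (nhds 0) := by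
      apply Tendsto.div_atTop tendsto_const_nhds
      exact tendsto_atTop_add_const_right _ _ tendsto_natCast_atTop_atTop
    obtain ⟨S, hS, hxS, hfr⟩ := zeno (z := fun n => γ (sk n)) (x := e x) (by
      intro U hU h0
      obtain ⟨δ', hδ', hb⟩ := key U hU h0
      filter_upwards [hlim.eventually (gt_mem_nhds hδ')] with n hn
      exact hb _ (by rw [abs_of_pos (hsk0 n)]; exact hn)) (fun n => hne _ (hsk0 n).ne')
    rcases hS with hS | hS
    · obtain ⟨n, hn⟩ := hfr.exists
      have := timeAxis_pos hS hxS hn (hne _ (hsk0 n).ne')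
      have := hneg _ ⟨hsk0 n, hsk1 n⟩
      linarith
    · obtain ⟨a, Λ, hΛ, rfl⟩ := hS
      obtain ⟨w0, hw0, hw0x⟩ := hxS
      have hin := lorentz_injective hΛ
      obtain ⟨K, hK0, hK⟩ := Λ.exists_antilipschitzWith (LinearMap.ker_eq_bot.2 hin)
      have hj : FCt (fun b : E3 => e.symm (e x + Λ (0, b))) := (FCt_space (e x) Λ hΛ).comp he.2
      obtain ⟨δ1, hδ1, h1⟩ := L1 hj (by
        intro b b' hbb
        have := e.symm.injective hbb
        simp only [add_right_inj] at this
        have := hin this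
        simpa using this)
      have hzl : Tendsto (fun n => (K : ℝ) * ‖γ (sk n) - e x‖) atTop (nhds 0) := by
        have : Tendsto (fun n => γ (sk n)) atTop (nhds (e x)) := by
          rw [← hγ0]
          exact (hcont.tendsto 0).comp hlim
        have := ((this.sub_const (e x)).norm.const_mul (K : ℝ))
        simpa using this
      obtain ⟨n, hn, hn2⟩ := (hfr.and_eventually (hzl.eventually (gt_mem_nhds hδ1))).exists
      obtain ⟨w, hw, hwx⟩ := hn
      simp only [Set.mem_ofPred_eq] at hw hw0
      simp only at hw0x hwx
      set b := w.2 - w0.2 with hb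
      have hwb : w - w0 = (0, b) := by
        ext1
        · simp [hw, hw0]
        · rfl
      have hΛb : Λ (0, b) = γ (sk n) - e x := by
        rw [← hwb, map_sub, ← hwx, ← hw0x]; abel
      have hb0 : b ≠ 0 := by
        intro h
        rw [h] at hΛb
        have h0 : ((0 : ℝ), (0 : E3)) = 0 := rfl
        rw [h0, map_zero] at hΛb
        exact hne _ (hsk0 n).ne' (sub_eq_zero.1 hΛb.symm)
      have hbs : ‖b‖ < δ1 := by
        refine lt_of_le_of_lt ?_ hn2
        rw [← hΛb]
        have h2 := hK.le_mul_dist (0, b) 0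
        simp only [dist_zero_right, map_zero] at h2
        exact (norm_snd_le ((0 : ℝ), b)).trans h2
      have h3 := h1 b (norm_pos_iff.2 hb0) hbs
      have h0 : ((0 : ℝ), (0 : E3)) = 0 := rfl
      rw [hΛb, h0, map_zero, add_zero, e.symm_apply_apply, add_sub_cancel] at h3
      simp only [hγ, e.symm_apply_apply, add_sub_cancel_left, qform_smul] at h3
      have := hsk0 n
      have : 0 < sk n ^ 2 * qform v := by positivity
      linarith

theorem germ {e : Mink ≃ Mink} (he : FH e) (x : Mink) {v : Mink} (hv : 0 < qform v) :
    ∃ δ : ℝ, 0 < δ ∧ ((∀ p p' : ℝ, 0 ≤ p → p < p' → p' ≤ δ → Chron (e (x + p • v)) (e (x + p' • v))) ∨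
      (∀ p p' : ℝ, 0 ≤ p → p < p' → p' ≤ δ → Chron (e (x + p' • v)) (e (x + p • v)))) := by
  obtain ⟨δ, hδ, c, ρ, hc, hform, -, -, hmono⟩ := L2 he x hv
  refine ⟨δ, hδ, ?_⟩
  rcases hmono with hm | hm
  · left
    intro p p' h1 h2 h3
    have hp : p ∈ Set.Icc 0 δ := ⟨h1, by linarith⟩
    have hp' : p' ∈ Set.Icc 0 δ := ⟨by linarith, h3⟩
    rw [hform p hp, hform p' hp']
    exact chron_line hc _ (hm hp hp' h2)
  · right
    intro p p' h1 h2 h3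
    have hp : p ∈ Set.Icc 0 δ := ⟨h1, by linarith⟩
    have hp' : p' ∈ Set.Icc 0 δ := ⟨by linarith, h3⟩
    rw [hform p hp, hform p' hp']
    exact chron_line hc _ (hm hp hp' h2)

theorem FH.symm {e : Mink ≃ Mink} (he : FH e) : FH e.symm := ⟨he.2, he.1⟩

theorem L3 {e : Mink ≃ Mink} (he : FH e) (x : Mink) :
    ∃ w : Mink, 0 < qform w ∧ ∃ δ : ℝ, 0 < δ ∧ ∀ s : ℝ, 0 < s → s < δ → Chron (e (x + s • w)) (e x) := by
  obtain ⟨δ, hδ, c, ρ, hc, hform, h0, hcont, hmono⟩ := L2 he.symm (e x)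
    (v := ((-1 : ℝ), (0 : E3))) (by simp [qform])
  have hchr : ∀ s : ℝ, 0 < s → Chron (e x + s • ((-1 : ℝ), (0 : E3))) (e x) := by
    intro s hs
    rw [chron_iff]
    simpa using hs
  have hδm : δ ∈ Set.Icc 0 δ := ⟨hδ.le, le_rfl⟩
  have h0m : 0 ∈ Set.Icc 0 δ := ⟨le_rfl, hδ.le⟩
  simp only [e.symm_apply_apply] at hform
  rcases hmono with hm | hm
  · refine ⟨((1 : ℝ), c), qform_one_pos hc, ρ δ, ?_, ?_⟩
    · rw [← h0]; exact hm h0m hδm hδ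
    · intro r hr0 hr
      obtain ⟨s, hs, hsr⟩ := intermediate_value_Icc hδ.le hcont (show r ∈ Set.Icc (ρ 0) (ρ δ) from
        ⟨by rw [h0]; exact hr0.le, hr.le⟩)
      have hs0 : s ≠ 0 := by
        rintro rfl
        rw [h0] at hsr
        exact hr0.ne hsr
      have := hform s hs
      rw [hsr] at this
      rw [← this, e.apply_symm_apply]
      exact hchr s (lt_of_le_of_ne hs.1 hs0.symm)
  · refine ⟨-((1 : ℝ), c), by rw [qform_neg]; exact qform_one_pos hc, -ρ δ, ?_, ?_⟩
    · have := hm h0m hδm hδ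
      rw [h0] at this
      linarith
    · intro r hr0 hr
      obtain ⟨s, hs, hsr⟩ := intermediate_value_Icc' hδ.le hcont
        (show -r ∈ Set.Icc (ρ δ) (ρ 0) from ⟨by linarith, by rw [h0]; linarith⟩)
      have hs0 : s ≠ 0 := by
        rintro rfl
        rw [h0] at hsr
        linarith
      have := hform s hs
      rw [hsr] at this
      rw [smul_neg, ← neg_smul, ← this, e.apply_symm_apply]
      exact hchr s (lt_of_le_of_ne hs.1 hs0.symm)
/-! ### One dimensional lemmas -/

theorem causal_of_germ {γ : ℝ → Mink} {a b : ℝ} (hab : a ≤ b) (hc : Continuous γ)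
    (h : ∀ r, a ≤ r → r < b → ∃ δ > 0, ∀ p, r < p → p < r + δ → Causal (γ r) (γ p)) :
    Causal (γ a) (γ b) := by
  have hcl : IsClosed {p | Causal (γ a) (γ p)} := isClosed_causal continuous_const hc
  have : Set.Icc a b ⊆ {p | Causal (γ a) (γ p)} := by
    apply IsClosed.Icc_subset_of_forall_exists_gt (hcl.inter isClosed_Icc) (causal_refl _)
    rintro x ⟨hx1, hx2⟩ y hy
    obtain ⟨δ, hδ, hp⟩ := h x hx2.1 hx2.2
    have hy' : x < y := hy
    have hm : x < min y (x + δ / 2) := lt_min hy' (by linarith)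
    refine ⟨min y (x + δ / 2), ?_, hm, min_le_left _ _⟩
    exact causal_trans hx1 (hp _ hm (by linarith [min_le_right y (x + δ / 2)]))
  exact this ⟨hab, le_rfl⟩

def GP (γ : ℝ → Mink) (s : ℝ) : Prop :=
  ∃ δ > 0, ∀ p p', s ≤ p → p < p' → p' ≤ s + δ → Chron (γ p) (γ p')

def GM (γ : ℝ → Mink) (s : ℝ) : Prop :=
  ∃ δ > 0, ∀ p p', s ≤ p → p < p' → p' ≤ s + δ → Chron (γ p') (γ p)

def LP (γ : ℝ → Mink) (s : ℝ) : Prop :=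
  ∃ δ > 0, ∀ p p', s - δ ≤ p → p < p' → p' ≤ s → Chron (γ p) (γ p')

def LM (γ : ℝ → Mink) (s : ℝ) : Prop :=
  ∃ δ > 0, ∀ p p', s - δ ≤ p → p < p' → p' ≤ s → Chron (γ p') (γ p)

/-- `γ` has a turning point of size `ε` at `s`. -/
def IsV (γ : ℝ → Mink) (ε s : ℝ) : Prop :=
  (∀ p p', s - ε < p → p ≤ p' → p' < s → Causal (γ p') (γ p)) ∧
    (∀ p p', s < p → p ≤ p' → p' < s + ε → Causal (γ p) (γ p'))

theorem GP_theta {γ : ℝ → Mink} {s : ℝ} : GP (fun t => theta (γ t)) s ↔ GM γ s := by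
  simp only [GP, GM, chron_theta]

theorem GM_theta {γ : ℝ → Mink} {s : ℝ} : GM (fun t => theta (γ t)) s ↔ GP γ s := by
  simp only [GP, GM, chron_theta]

theorem LP_theta {γ : ℝ → Mink} {s : ℝ} : LP (fun t => theta (γ t)) s ↔ LM γ s := by
  simp only [LP, LM, chron_theta]

theorem LM_theta {γ : ℝ → Mink} {s : ℝ} : LM (fun t => theta (γ t)) s ↔ LP γ s := by
  simp only [LP, LM, chron_theta]

theorem causal_of_chron_or_eq {γ : ℝ → Mink} {p p' : ℝ} (hp : p ≤ p')
    (h : p < p' → Chron (γ p) (γ p')) : Causal (γ p) (γ p') := by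
  rcases eq_or_lt_of_le hp with rfl | h'
  · exact causal_refl _
  · exact (h h').causal

theorem isV_of_germs {γ : ℝ → Mink} {s : ℝ} (h1 : GP γ s) (h2 : LM γ s) :
    ∃ ε > 0, IsV γ ε s := by
  obtain ⟨δ, hδ, h1⟩ := h1
  obtain ⟨δ', hδ', h2⟩ := h2
  refine ⟨min δ δ', lt_min hδ hδ', ?_, ?_⟩
  · intro p p' a b c
    rcases eq_or_lt_of_le b with rfl | h'
    · exact causal_refl _
    · exact (h2 p p' (by linarith [min_le_right δ δ']) h' c.le).causal
  · intro p p' a b c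
    rcases eq_or_lt_of_le b with rfl | h'
    · exact causal_refl _
    · exact (h1 p p' a.le h' (by linarith [min_le_left δ δ'])).causal

theorem chron_of_GP {γ : ℝ → Mink} (hc : Continuous γ) (h : ∀ s, GP γ s) :
    ∀ p p', p < p' → Chron (γ p) (γ p') := by
  have hca : ∀ p p', p ≤ p' → Causal (γ p) (γ p') := by
    intro p p' hp
    apply causal_of_germ hp hc
    intro r _ _
    obtain ⟨δ, hδ, h1⟩ := h r
    exact ⟨δ, hδ, fun q h2 h3 => (h1 r q le_rfl h2 h3.le).causal⟩
  intro p p' hp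
  obtain ⟨δ, hδ, h1⟩ := h p
  have hm : p < min p' (p + δ) := lt_min hp (by linarith)
  exact chron_causal (h1 p _ le_rfl hm (min_le_right _ _)) (hca _ _ (min_le_left _ _))

theorem isOpen_GP {γ : ℝ → Mink} (h : ∀ s, GP γ s → LP γ s) : IsOpen {s | GP γ s} := by
  rw [Metric.isOpen_iff]
  intro s hs
  obtain ⟨δ', hδ', h2⟩ := h s hs
  obtain ⟨δ, hδ, h1⟩ := hs
  refine ⟨min δ δ', lt_min hδ hδ', ?_⟩
  intro q hq
  rw [Metric.mem_ball, Real.dist_eq, abs_lt] at hq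
  have m1 := min_le_left δ δ'
  have m2 := min_le_right δ δ'
  rcases lt_or_ge q s with hqs | hqs
  · exact ⟨s - q, by linarith, fun p p' a b c => h2 p p' (by linarith) b (by linarith)⟩
  · exact ⟨s + δ - q, by linarith, fun p p' a b c => h1 p p' (by linarith) b (by linarith)⟩

theorem lemmaB {γ : ℝ → Mink} (hc : Continuous γ) (hR : ∀ s, GP γ s ∨ GM γ s)
    (hL : ∀ s, LP γ s ∨ LM γ s) (hV : ∀ s, ∀ ε > 0, ¬ IsV γ ε s)
    (hV' : ∀ s, ∀ ε > 0, ¬ IsV (fun t => theta (γ t)) ε s) :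
    (∀ p p', p < p' → Chron (γ p) (γ p')) ∨ (∀ p p', p < p' → Chron (γ p') (γ p)) := by
  have h1 : ∀ s, GP γ s → LP γ s := by
    intro s hs
    rcases hL s with h | h
    · exact h
    · obtain ⟨ε, hε, hh⟩ := isV_of_germs hs h
      exact absurd hh (hV s ε hε)
  have h2 : ∀ s, GM γ s → LM γ s := by
    intro s hs
    rcases hL s with h | h
    · obtain ⟨ε, hε, hh⟩ := isV_of_germs (GP_theta.2 hs) (LM_theta.2 h)
      exact absurd hh (hV' s ε hε)
    · exact h
  have o1 := isOpen_GP h1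
  have o2 : IsOpen {s | GM γ s} := by
    have := isOpen_GP (γ := fun t => theta (γ t)) (by simpa only [GP_theta, LP_theta] using h2)
    simpa only [GP_theta] using this
  have hdis : ∀ s, GP γ s → GM γ s → False := by
    rintro s ⟨δ, hδ, a⟩ ⟨δ', hδ', b⟩
    have hm : 0 < min δ δ' := lt_min hδ hδ'
    have m1 := min_le_left δ δ'
    have m2 := min_le_right δ δ'
    exact chron_irrefl _ (chron_causal (a s (s + min δ δ') le_rfl (by linarith) (by linarith))
      (b s (s + min δ δ') le_rfl (by linarith) (by linarith)).causal)
  have hcl : IsClopen {s | GP γ s} := by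
    refine ⟨?_, o1⟩
    rw [← isOpen_compl_iff]
    convert o2 using 1
    ext s
    constructor
    · intro hs
      exact (hR s).resolve_left hs
    · intro hs hs'
      exact hdis s hs' hs
  rcases isClopen_iff.1 hcl with h | h
  · right
    have hGM : ∀ s, GM γ s := by
      intro s
      rcases hR s with h' | h'
      · have : s ∈ {s | GP γ s} := h'
        rw [h] at this
        exact absurd this (Set.notMem_empty s)
      · exact h'
    have := chron_of_GP (γ := fun t => theta (γ t)) (theta_continuous.comp hc)
      (by simpa only [GP_theta] using hGM)
    simpa only [chron_theta] using this
  · left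
    apply chron_of_GP hc
    intro s
    have : s ∈ {s | GP γ s} := by rw [h]; trivial
    exact this

/-! ### The core two dimensional lemma -/

theorem wmono {H : ℝ → ℝ → Mink} {κ : ℝ} (hκ : 0 < κ)
    (c3 : ∀ s α, Continuous (fun r => H (s + κ * r) (α + r)))
    (h2 : ∀ s α, ∃ δ > 0, ∀ r, 0 < r → r < δ → qform (H s (α + r) - H s α) < 0)
    (h3 : ∀ s α, ∃ δ > 0, (∀ r, 0 < r → r < δ → Chron (H s α) (H (s + κ * r) (α + r))) ∨
      (∀ r, 0 < r → r < δ → Chron (H (s + κ * r) (α + r)) (H s α)))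
    {lo hi : ℝ → ℝ} (hlo : Continuous lo) {α1 ℓ s1 : ℝ} (hℓ : 0 ≤ ℓ)
    (hm : ∀ r, 0 ≤ r → r ≤ ℓ → ∀ s s', lo (α1 + r) < s → s ≤ s' → s' < hi (α1 + r) →
      Causal (H s (α1 + r)) (H s' (α1 + r)))
    (hr : ∀ r, 0 ≤ r → r ≤ ℓ → lo (α1 + r) < s1 + κ * r ∧ s1 + κ * r < hi (α1 + r)) :
    Causal (H s1 α1) (H (s1 + κ * ℓ) (α1 + ℓ)) := by
  have := causal_of_germ (γ := fun r => H (s1 + κ * r) (α1 + r)) hℓ (c3 s1 α1) (by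
    intro r hr0 hrl
    obtain ⟨δ, hδ, h⟩ := h3 (s1 + κ * r) (α1 + r)
    have e1 : ∀ p, s1 + κ * r + κ * (p - r) = s1 + κ * p := fun p => by ring
    have e2 : ∀ p, α1 + r + (p - r) = α1 + p := fun p => by ring
    rcases h with h | h
    · refine ⟨δ, hδ, fun p hp1 hp2 => ?_⟩
      have := h (p - r) (by linarith) (by linarith)
      rw [e1, e2] at this
      exact this.causal
    · exfalso
      obtain ⟨δ2, hδ2, h2'⟩ := h2 (s1 + κ * r) (α1 + r)
      have hcl : ∀ᶠ r' in nhdsWithin (0 : ℝ) (Set.Ioi 0), lo (α1 + r + r') < s1 + κ * r := by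
        have : Tendsto (fun r' => lo (α1 + r + r')) (nhds 0) (nhds (lo (α1 + r))) := by
          have h : Continuous (fun r' => lo (α1 + r + r')) := by fun_prop
          have := h.tendsto 0
          simpa using this
        exact (this.eventually (gt_mem_nhds (hr r hr0 hrl.le).1)).filter_mono nhdsWithin_le_nhds
      obtain ⟨r', ⟨h5, h6⟩, h7⟩ := ((Ioo_mem_nhdsGT (show (0 : ℝ) < min (min δ δ2) (ℓ - r) from
        lt_min (lt_min hδ hδ2) (by linarith))) |> fun h => (Filter.eventually_of_mem h
          (fun x hx => hx)).and hcl).exists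
      rw [lt_min_iff, lt_min_iff] at h6
      have a1 := h r' h5 h6.1.1
      have e3 : α1 + r + r' = α1 + (r + r') := by ring
      have hpos : 0 < κ * r' := mul_pos hκ h5
      have a2 : Causal (H (s1 + κ * r) (α1 + r + r'))
          (H (s1 + κ * r + κ * r') (α1 + r + r')) := by
        have h8 := (hr (r + r') (by linarith) (by linarith)).2
        rw [e3] at h7 ⊢
        refine hm (r + r') (by linarith) (by linarith) _ _ h7 (by linarith) ?_
        linarith [mul_add κ r r']
      have a3 := causal_chron a2 a1
      have a4 := h2' r' h5 h6.1.2
      have a5 := (qform_pos_chron (H (s1 + κ * r) (α1 + r)) (H (s1 + κ * r) (α1 + r + r'))).2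
        (Or.inr a3)
      linarith)
  simpa using this

theorem core2D {H : ℝ → ℝ → Mink} {κ : ℝ} (hκ : 0 < κ) (c1 : ∀ α, Continuous (fun s => H s α))
    (c3 : ∀ s α, Continuous (fun r => H (s + κ * r) (α + r)))
    (h2 : ∀ s α, ∃ δ > 0, ∀ r, 0 < r → r < δ → qform (H s (α + r) - H s α) < 0)
    (h3 : ∀ s α, ∃ δ > 0, (∀ r, 0 < r → r < δ → Chron (H s α) (H (s + κ * r) (α + r))) ∨
      (∀ r, 0 < r → r < δ → Chron (H (s + κ * r) (α + r)) (H s α)))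
    {T : ℝ → ℝ} (hT : Continuous T) {a ε : ℝ} (ha : 0 < a) (hε : 0 < ε)
    (h4 : ∀ α, 0 ≤ α → α ≤ a → IsV (fun s => H s α) ε (T α))
    (h5 : ∀ s α s' α', H s α = H s' α' → α = α')
    {δ : ℝ} (hδ : 0 < δ) (h6 : ∀ r, 0 < r → r < δ → Chron (H (T 0 + κ * r) r) (H (T 0) 0)) :
    False := by
  set s0 := T 0 with hs0
  set σ : ℝ → ℝ := fun α => T α - κ * α - s0 with hσ
  have hσc : Continuous σ := by fun_prop
  have hσ0 : σ 0 = 0 := by simp [hσ, hs0]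
  obtain ⟨a', ha'0, ha'a, ha'δ, hσs⟩ : ∃ a' > 0, a' ≤ a ∧ a' < δ ∧
      ∀ α, 0 ≤ α → α ≤ a' → |σ α| < ε / 4 := by
    have h := hσc.tendsto 0
    rw [hσ0] at h
    have h := h.eventually (Metric.ball_mem_nhds 0 (show 0 < ε / 4 by linarith))
    obtain ⟨η, hη, h⟩ := Metric.eventually_nhds_iff.1 h
    refine ⟨min (min a (δ / 2)) (η / 2), lt_min (lt_min ha (by linarith)) (by linarith), ?_, ?_, ?_⟩
    · exact (min_le_left _ _).trans (min_le_left _ _)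
    · have : min (min a (δ / 2)) (η / 2) ≤ δ / 2 := (min_le_left _ _).trans (min_le_right _ _)
      linarith
    · intro α h0 h1
      have h1 := h1.trans (min_le_right _ _)
      have := h (y := α) (by rw [Real.dist_eq, sub_zero, abs_of_nonneg h0]; linarith)
      simpa using this
  set B : ℝ → ℝ → Mink := fun β α => H (s0 + κ * α + β) α with hB
  have hBc : ∀ α, Continuous (fun β => B β α) := fun α => by
    have := c1 α
    exact this.comp (by fun_prop)
  -- vertical moves
  have vp : ∀ α, 0 ≤ α → α ≤ a' → ∀ β β', σ α < β → β ≤ β' → β' < σ α + ε →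
      Causal (B β α) (B β' α) := by
    intro α h0 h1 β β' x y z
    simp only [hσ] at x z
    exact (h4 α h0 (h1.trans ha'a)).2 _ _ (by linarith) (by linarith) (by linarith)
  have vm : ∀ α, 0 ≤ α → α ≤ a' → ∀ β β', σ α - ε < β → β ≤ β' → β' < σ α →
      Causal (B β' α) (B β α) := by
    intro α h0 h1 β β' x y z
    simp only [hσ] at x z
    exact (h4 α h0 (h1.trans ha'a)).1 _ _ (by linarith) (by linarith) (by linarith)
  -- moves along `w`
  have ap : ∀ α1 α2, 0 ≤ α1 → α1 ≤ α2 → α2 ≤ a' → ∀ β,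
      (∀ α, α1 ≤ α → α ≤ α2 → σ α < β ∧ β < σ α + ε) → Causal (B β α1) (B β α2) := by
    intro α1 α2 h0 h1 h2' β hβ
    have := wmono hκ c3 h2 h3 (lo := T) (hi := fun α => T α + ε) hT (α1 := α1) (ℓ := α2 - α1)
      (s1 := s0 + κ * α1 + β) (by linarith)
      (fun r hr0 hr s s' x y z => (h4 (α1 + r) (by linarith) (by linarith)).2 s s' x y z)
      (by
        intro r hr0 hr
        have := hβ (α1 + r) (by linarith) (by linarith)
        simp only [hσ] at this
        constructor <;> nlinarith [this.1, this.2])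
    have e1 : s0 + κ * α1 + β + κ * (α2 - α1) = s0 + κ * α2 + β := by ring
    have e2 : α1 + (α2 - α1) = α2 := by ring
    rw [e1, e2] at this
    exact this
  have am : ∀ α1 α2, 0 ≤ α1 → α1 ≤ α2 → α2 ≤ a' → ∀ β,
      (∀ α, α1 ≤ α → α ≤ α2 → σ α - ε < β ∧ β < σ α) → Causal (B β α2) (B β α1) := by
    intro α1 α2 h0 h1 h2' β hβ
    have := wmono (H := fun s α => theta (H s α)) hκ
      (fun s α => theta_continuous.comp (c3 s α)) (by simpa only [qform_theta_sub] using h2)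
      (by
        intro s α
        obtain ⟨δ, hδ, h⟩ := h3 s α
        refine ⟨δ, hδ, ?_⟩
        simp only [chron_theta]
        exact h.symm)
      (lo := fun α => T α - ε) (hi := T) (by fun_prop) (α1 := α1) (ℓ := α2 - α1)
      (s1 := s0 + κ * α1 + β) (by linarith)
      (fun r hr0 hr s s' x y z => by
        rw [causal_theta]
        exact (h4 (α1 + r) (by linarith) (by linarith)).1 s s' x y z)
      (by
        intro r hr0 hr
        have := hβ (α1 + r) (by linarith) (by linarith)
        simp only [hσ] at this
        constructor <;> nlinarith [this.1, this.2])
    have e1 : s0 + κ * α1 + β + κ * (α2 - α1) = s0 + κ * α2 + β := by ring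
    have e2 : α1 + (α2 - α1) = α2 := by ring
    rw [e1, e2, causal_theta] at this
    exact this
  have hev : ∀ᶠ η in nhdsWithin (0 : ℝ) (Set.Ioi 0), 0 < η ∧ η < ε / 4 :=
    Ioo_mem_nhdsGT (by linarith)
  have limp : ∀ β α, Tendsto (fun η => B (β + η) α) (nhdsWithin (0 : ℝ) (Set.Ioi 0))
      (nhds (B β α)) := by
    intro β α
    have : Continuous (fun η => B (β + η) α) := (hBc α).comp (by fun_prop)
    have := this.tendsto 0
    rw [add_zero] at this
    exact this.mono_left nhdsWithin_le_nhds
  have limm : ∀ β α, Tendsto (fun η => B (β - η) α) (nhdsWithin (0 : ℝ) (Set.Ioi 0))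
      (nhds (B β α)) := by
    intro β α
    have : Continuous (fun η => B (β - η) α) := (hBc α).comp (by fun_prop)
    have := this.tendsto 0
    rw [sub_zero] at this
    exact this.mono_left nhdsWithin_le_nhds
  have habs : ∀ α, 0 ≤ α → α ≤ a' → -(ε / 4) < σ α ∧ σ α < ε / 4 :=
    fun α h0 h1 => abs_lt.1 (hσs α h0 h1)
  by_cases hcase : ∀ α, 0 ≤ α → α ≤ a' → σ α ≤ 0
  · have h7 : Causal (B 0 0) (B 0 a') := by
      refine causal_lim (limp 0 0) (limp 0 a') ?_
      filter_upwards [hev] with η hη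
      refine ap 0 a' le_rfl ha'0.le le_rfl _ ?_
      intro α h0 h1
      have := habs α h0 h1
      have := hcase α h0 h1
      constructor <;> linarith [hη.1, hη.2]
    have h8 := h6 a' ha'0 ha'δ
    simp only [hB, mul_zero, add_zero] at h7
    exact chron_irrefl _ (chron_causal h8 h7)
  · push Not at hcase
    obtain ⟨α', h0', h1', h2'⟩ := hcase
    obtain ⟨α2, hα2, hmax⟩ := isCompact_Icc.exists_isMaxOn (s := Set.Icc 0 a')
      ⟨0, le_rfl, ha'0.le⟩ hσc.continuousOn
    have hσ2 : 0 < σ α2 := lt_of_lt_of_le h2' (hmax ⟨h0', h1'⟩)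
    obtain ⟨α1, hα1, hmin⟩ := isCompact_Icc.exists_isMinOn (s := Set.Icc 0 α2)
      ⟨0, le_rfl, hα2.1⟩ hσc.continuousOn
    have hσ1 : σ α1 ≤ 0 := by
      rw [← hσ0]
      exact hmin ⟨le_rfl, hα2.1⟩
    have hb1 := habs α1 hα1.1 (hα1.2.trans hα2.2)
    have hb2 := habs α2 hα2.1 hα2.2
    have k1 : Causal (B (σ α1) α1) (B (σ α2) α2) := by
      refine causal_lim (limp _ _) (limp _ _) ?_
      filter_upwards [hev] with η hη
      refine causal_trans (vp α1 hα1.1 (hα1.2.trans hα2.2) (σ α1 + η) (σ α2 + η) (by linarith)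
        (by linarith) (by linarith)) (ap α1 α2 hα1.1 hα1.2 hα2.2 _ ?_)
      intro α x y
      have := habs α (hα1.1.trans x) (y.trans hα2.2)
      have h9 : σ α ≤ σ α2 := hmax ⟨hα1.1.trans x, y.trans hα2.2⟩
      constructor <;> linarith [hη.1, hη.2]
    have k2 : Causal (B (σ α2) α2) (B (σ α1) α1) := by
      refine causal_lim (limm _ _) (limm _ _) ?_
      filter_upwards [hev] with η hη
      refine causal_trans (vm α2 hα2.1 hα2.2 (σ α1 - η) (σ α2 - η) (by linarith)
        (by linarith) (by linarith)) (am α1 α2 hα1.1 hα1.2 hα2.2 _ ?_)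
      intro α x y
      have := habs α (hα1.1.trans x) (y.trans hα2.2)
      have h9 : σ α1 ≤ σ α := hmin ⟨hα1.1.trans x, y⟩
      constructor <;> linarith [hη.1, hη.2]
    have := h5 _ _ _ _ (causal_antisymm k1 k2)
    rw [this] at hσ1
    linarith
/-! ### Affine maps are fine continuous -/

theorem FC_affine (a : Mink) {r : ℝ} (hr : r ≠ 0) {Λ : Mink →ₗ[ℝ] Mink}
    (hΛ : ∀ v, qform (Λ v) = qform v) : FC (fun x => a + r • Λ x) := by
  have hc : Continuous Λ := Λ.continuous_of_finiteDimensional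
  apply FC_of_FCt
  intro S hS
  have hcont : Continuous (fun x : S => a + r • Λ x) := by fun_prop
  rcases hS with ⟨a', v, hv, rfl⟩ | ⟨a', Λ', hΛ', rfl⟩
  · have hq : 0 < qform (r • Λ v) := by
      rw [qform_smul, hΛ]
      have := (qform_pos_iff v).2 hv
      positivity
    refine FCt_of_axis hcont (Or.inl (isTimeAxis_line (a + r • Λ a') (r • Λ v) hq)) ?_
    rintro ⟨_, t, rfl⟩
    refine ⟨t, ?_⟩
    simp only [map_add, map_smul, smul_add]
    rw [smul_comm t r, add_assoc]
  · refine FCt_of_axis hcont (Or.inr ⟨a + r • Λ a', Λ ∘ₗ Λ', fun v => ?_, rfl⟩) ?_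
    · simp [hΛ, hΛ']
    · rintro ⟨_, w, hw, rfl⟩
      refine ⟨r • w, ?_, ?_⟩
      · simp only [Set.mem_ofPred_eq] at hw ⊢
        simp [hw]
      · simp only [map_add, map_smul, smul_add, LinearMap.comp_apply]
        rw [add_assoc]

def thetaLin : Mink →ₗ[ℝ] Mink where
  toFun := theta
  map_add' x y := by
    ext1
    · simp only [theta, Prod.fst_add]; ring
    · simp [theta]
  map_smul' r x := by
    ext1
    · simp [theta]
    · simp [theta]

theorem thetaLin_apply (x : Mink) : thetaLin x = theta x := rfl

theorem qform_theta (x : Mink) : qform (theta x) = qform x := by simp [theta, qform]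

def thetaEquiv : Mink ≃ Mink := ⟨theta, theta, theta_theta, theta_theta⟩

theorem FC_theta : FC theta := by
  have := FC_affine 0 one_ne_zero (Λ := thetaLin) (fun v => qform_theta v)
  simpa [thetaLin_apply] using this

theorem FC.comp {f g : Mink → Mink} (hf : FC f) (hg : FC g) : FC (fun x => f (g x)) :=
  fun U hU => hg _ (hf U hU)

theorem FH.theta {e : Mink ≃ Mink} (he : FH e) : FH (e.trans thetaEquiv) :=
  ⟨FC_theta.comp he.1, he.2.comp FC_theta⟩

/-! ### Families of parallel lines -/

/-- The image under `e` of the line in direction `v` through `(0, b)`. -/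
def Fl (e : Mink ≃ Mink) (v : Mink) (b : E3) (s : ℝ) : Mink := e (((0 : ℝ), b) + s • v)

theorem Fl_continuous {e : Mink ≃ Mink} (he : FH e) {v : Mink} (hv : 0 < qform v) (b : E3) :
    Continuous (Fl e v b) := ((FCt_line _ v hv).comp he.1).continuous

theorem Fl_continuous_b {e : Mink ≃ Mink} (he : FH e) (v : Mink) (s : ℝ) :
    Continuous (fun b => Fl e v b s) := by
  have := ((FCt_slice (s • v)).comp he.1).continuous
  unfold Fl
  simpa only [add_comm] using this

theorem Fl_inj {e : Mink ≃ Mink} {v : Mink} (hv : 0 < qform v) {b b' : E3} {s s' : ℝ}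
    (h : Fl e v b s = Fl e v b' s') : s = s' ∧ b = b' := by
  have h := e.injective h
  have hv1 := fst_ne_zero_of_qform_pos hv
  have h1 := congrArg Prod.fst h
  have h2 := congrArg Prod.snd h
  simp at h1 h2
  have h3 : s = s' := by
    rcases h1 with h1 | h1
    · exact h1
    · exact absurd h1 hv1
  refine ⟨h3, ?_⟩
  rw [h3] at h2
  exact add_right_cancel h2

theorem Fl_right {e : Mink ≃ Mink} (he : FH e) {v : Mink} (hv : 0 < qform v) (b : E3) (s : ℝ) :
    GP (Fl e v b) s ∨ GM (Fl e v b) s := by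
  obtain ⟨δ, hδ, h⟩ := germ he (((0 : ℝ), b) + s • v) hv
  have e1 : ∀ p : ℝ, ((0 : ℝ), b) + s • v + (p - s) • v = ((0 : ℝ), b) + p • v := fun p => by
    rw [sub_smul]; abel
  rcases h with h | h
  · left
    refine ⟨δ, hδ, fun p p' h1 h2 h3 => ?_⟩
    have := h (p - s) (p' - s) (by linarith) (by linarith) (by linarith)
    rw [e1, e1] at this
    exact this
  · right
    refine ⟨δ, hδ, fun p p' h1 h2 h3 => ?_⟩
    have := h (p - s) (p' - s) (by linarith) (by linarith) (by linarith)
    rw [e1, e1] at this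
    exact this

theorem Fl_left {e : Mink ≃ Mink} (he : FH e) {v : Mink} (hv : 0 < qform v) (b : E3) (s : ℝ) :
    LP (Fl e v b) s ∨ LM (Fl e v b) s := by
  obtain ⟨δ, hδ, h⟩ := germ he (((0 : ℝ), b) + s • v) (v := -v) (by rwa [qform_neg])
  have e1 : ∀ p : ℝ, ((0 : ℝ), b) + s • v + (s - p) • (-v) = ((0 : ℝ), b) + p • v := fun p => by
    rw [smul_neg, sub_smul]; abel
  rcases h with h | h
  · right
    refine ⟨δ, hδ, fun p p' h1 h2 h3 => ?_⟩
    have := h (s - p') (s - p) (by linarith) (by linarith) (by linarith)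
    rw [e1, e1] at this
    exact this
  · left
    refine ⟨δ, hδ, fun p p' h1 h2 h3 => ?_⟩
    have := h (s - p') (s - p) (by linarith) (by linarith) (by linarith)
    rw [e1, e1] at this
    exact this

theorem isClosed_isV {e : Mink ≃ Mink} (he : FH e) (v : Mink) (ε : ℝ) :
    IsClosed {x : ℝ × E3 | IsV (Fl e v x.2) ε x.1} := by
  have hc : ∀ p, Continuous (fun x : ℝ × E3 => Fl e v x.2 p) := fun p =>
    (Fl_continuous_b he v p).comp continuous_snd
  have hco : ∀ p p', IsClosed {x : ℝ × E3 | Causal (Fl e v x.2 p) (Fl e v x.2 p')} :=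
    fun p p' => isClosed_causal (hc p) (hc p')
  simp only [IsV, Set.ofPred_and, Set.ofPred_forall]
  apply IsClosed.inter
  · refine isClosed_iInter fun p => isClosed_iInter fun p' => ?_
    apply isClosed_imp (isOpen_lt (by fun_prop) (by fun_prop))
    apply isClosed_imp (by simp)
    apply isClosed_imp (isOpen_lt (by fun_prop) (by fun_prop))
    exact hco _ _
  · refine isClosed_iInter fun p => isClosed_iInter fun p' => ?_
    apply isClosed_imp (isOpen_lt (by fun_prop) (by fun_prop))
    apply isClosed_imp (by simp)
    apply isClosed_imp (isOpen_lt (by fun_prop) (by fun_prop))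
    exact hco _ _

theorem isV_unique {γ : ℝ → Mink} (hinj : Function.Injective γ) {ε s s' : ℝ} (h : IsV γ ε s)
    (h' : IsV γ ε s') (h1 : s < s') (h2 : s' < s + ε) : False := by
  have a1 := h.2 ((2 * s + s') / 3) ((s + 2 * s') / 3) (by linarith) (by linarith) (by linarith)
  have a2 := h'.1 ((2 * s + s') / 3) ((s + 2 * s') / 3) (by linarith) (by linarith) (by linarith)
  have := hinj (causal_antisymm a1 a2)
  linarith

theorem continuous_of_closed {C : Set (ℝ × E3)} (hC : IsClosed C) {K : Set ℝ} (hK : IsCompact K)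
    {O : Set E3} {τ : E3 → ℝ} (h1 : ∀ b ∈ O, τ b ∈ K) (h2 : ∀ b ∈ O, (τ b, b) ∈ C)
    (h3 : ∀ b ∈ O, ∀ y ∈ K, (y, b) ∈ C → y = τ b) : ContinuousOn τ O := by
  intro b hb
  apply hK.tendsto_nhds_of_unique_mapClusterPt
  · filter_upwards [self_mem_nhdsWithin] with x hx using h1 x hx
  · intro y hy hcl
    apply h3 b hb y hy
    rw [← hC.closure_eq, mem_closure_iff_nhds]
    intro t ht
    obtain ⟨u, hu, w, hw, hsub⟩ := mem_nhds_prod_iff.1 ht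
    have hfr := mapClusterPt_iff_frequently.1 hcl u hu
    obtain ⟨x, hx1, hx2, hx3⟩ := (hfr.and_eventually ((eventually_of_mem self_mem_nhdsWithin
      (fun x hx => hx)).and (mem_nhdsWithin_of_mem_nhds hw))).exists
    exact ⟨(τ x, x), hsub ⟨hx1, hx3⟩, h2 x hx2⟩

theorem noOpen_aux {e : Mink ≃ Mink} (he : FH e) {v : Mink} (hv : 0 < qform v) {ε : ℝ} (hε : 0 < ε)
    {O : Set E3} (hO : IsOpen O) {τ : E3 → ℝ} (hτc : ContinuousOn τ O)
    (hτ : ∀ b ∈ O, IsV (Fl e v b) ε (τ b)) {b0 : E3} (hb0 : b0 ∈ O) {w : Mink} (hw : 0 < qform w)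
    (hκ : 0 < w.1 / v.1) {δ : ℝ} (hδ : 0 < δ)
    (h6 : ∀ r : ℝ, 0 < r → r < δ → Chron (e (((0 : ℝ), b0) + τ b0 • v + r • w))
      (e (((0 : ℝ), b0) + τ b0 • v))) : False := by
  set κ := w.1 / v.1 with hκdef
  set d := w.2 - κ • v.2 with hd
  have hv1 := fst_ne_zero_of_qform_pos hv
  have hwv : w = κ • v + ((0 : ℝ), d) := by
    ext1
    · simp [hκdef, hv1]
    · simp [hd]
  by_cases hd0 : d = 0
  · have hwv' : w = κ • v := by
      rw [hwv, hd0]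
      have h0 : ((0 : ℝ), (0 : E3)) = 0 := rfl
      rw [h0, add_zero]
    have hV := hτ b0 hb0
    have hcon := Fl_continuous he hv b0
    set r := min (δ / 2) (ε / (2 * κ)) with hr
    have hr0 : 0 < r := lt_min (by linarith) (by positivity)
    have hrδ : r < δ := by
      have : r ≤ δ / 2 := min_le_left _ _
      linarith
    have hrε : r * κ < ε := by
      have : r ≤ ε / (2 * κ) := min_le_right _ _
      rw [le_div_iff₀ (by positivity)] at this
      nlinarith
    have hrκ : 0 < r * κ := mul_pos hr0 hκ
    have h7 := h6 r hr0 hrδ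
    rw [hwv', smul_smul, add_assoc, ← add_smul] at h7
    have h8 : Causal (Fl e v b0 (τ b0)) (Fl e v b0 (τ b0 + r * κ)) := by
      refine causal_lim (l := nhdsWithin (τ b0) (Set.Ioi (τ b0)))
        ((hcon.tendsto _).mono_left nhdsWithin_le_nhds) tendsto_const_nhds ?_
      filter_upwards [Ioo_mem_nhdsGT (show τ b0 < τ b0 + r * κ by linarith)] with p hp
      exact hV.2 _ _ hp.1 hp.2.le (by linarith)
    exact chron_irrefl _ (chron_causal h7 h8)
  · have hdn := norm_pos_iff.2 hd0
    obtain ⟨η, hη, hball⟩ := Metric.isOpen_iff.1 hO b0 hb0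
    set a := η / (2 * ‖d‖) with ha
    have ha0 : 0 < a := by positivity
    have hmem : ∀ α, 0 ≤ α → α ≤ a → b0 + α • d ∈ O := by
      intro α h0 h1
      apply hball
      rw [Metric.mem_ball, dist_eq_norm, add_sub_cancel_left, norm_smul, Real.norm_eq_abs,
        abs_of_nonneg h0]
      rw [ha, le_div_iff₀ (by positivity)] at h1
      nlinarith
    have hline : ∀ s α r : ℝ, ((0 : ℝ), b0 + (α + r) • d) + (s + κ * r) • v =
        ((0 : ℝ), b0 + α • d) + s • v + r • w := by
      intro s α r
      rw [hwv]
      ext1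
      · simp; ring
      · simp only [Prod.snd_add, Prod.smul_snd]
        module
    set T : ℝ → ℝ := fun α => τ (b0 + (max 0 (min α a)) • d) with hT
    have hclamp : ∀ α, 0 ≤ α → α ≤ a → max 0 (min α a) = α := fun α h0 h1 => by
      rw [min_eq_left h1, max_eq_right h0]
    have hTc : Continuous T := by
      apply hτc.comp_continuous (by fun_prop)
      intro α
      exact hmem _ (le_max_left _ _) (max_le ha0.le (min_le_right _ _))
    have hT0 : T 0 = τ b0 := by
      simp only [hT]
      rw [hclamp 0 le_rfl ha0.le, zero_smul, add_zero]
    refine core2D (H := fun s α => Fl e v (b0 + α • d) s) hκ (T := T) (a := a) (ε := ε) (δ := δ)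
      ?_ ?_ ?_ ?_ hTc ha0 hε ?_ ?_ hδ ?_
    · intro α
      exact Fl_continuous he hv _
    · intro s α
      simp only [Fl, hline]
      exact ((FCt_line _ w hw).comp he.1).continuous
    · intro s α
      obtain ⟨δ1, hδ1, h1⟩ := L1 ((FCt_slice (((0 : ℝ), b0 + α • d) + s • v)).comp he.1) (by
        intro b b' hbb
        have := e.injective hbb
        simpa using this)
      refine ⟨δ1 / ‖d‖, by positivity, fun r hr0 hr => ?_⟩
      rw [lt_div_iff₀ hdn] at hr
      have hn : ‖r • d‖ = r * ‖d‖ := by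
        rw [norm_smul, Real.norm_eq_abs, abs_of_pos hr0]
      have := h1 (r • d) (by rw [hn]; positivity) (by rw [hn]; exact hr)
      have e0 : ((0 : ℝ), (0 : E3)) = 0 := rfl
      have e2 : ((0 : ℝ), b0 + (α + r) • d) + s • v =
          ((0 : ℝ), b0 + α • d) + s • v + ((0 : ℝ), r • d) := by
        ext1
        · simp
        · simp only [Prod.snd_add, Prod.smul_snd]
          module
      rw [e0, add_zero, ← e2] at this
      exact this
    · intro s α
      obtain ⟨δ1, hδ1, h⟩ := germ he (((0 : ℝ), b0 + α • d) + s • v) hw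
      refine ⟨δ1, hδ1, ?_⟩
      simp only [Fl, hline]
      rcases h with h | h
      · left
        intro r h0 h1
        have := h 0 r le_rfl h0 h1.le
        rw [zero_smul, add_zero] at this
        exact this
      · right
        intro r h0 h1
        have := h 0 r le_rfl h0 h1.le
        rw [zero_smul, add_zero] at this
        exact this
    · intro α h0 h1
      simp only [hT]
      rw [hclamp α h0 h1]
      exact hτ _ (hmem α h0 h1)
    · intro s α s' α' h
      have := (Fl_inj hv h).2
      simp only [add_right_inj] at this
      exact smul_left_injective ℝ hd0 this
    · intro r h0 h1
      have := h6 r h0 h1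
      have e3 := hline (τ b0) 0 r
      rw [zero_add, zero_smul, add_zero] at e3
      rw [hT0]
      simp only [Fl, zero_smul, add_zero]
      rw [e3]
      exact this

theorem isV_neg {e : Mink ≃ Mink} {v : Mink} {ε s : ℝ} {b : E3} (h : IsV (Fl e v b) ε s) :
    IsV (Fl e (-v) b) ε (-s) := by
  have hF : ∀ p, Fl e (-v) b p = Fl e v b (-p) := fun p => by
    unfold Fl
    rw [smul_neg, neg_smul]
  constructor
  · intro p p' x y z
    rw [hF, hF]
    exact h.2 _ _ (by linarith) (by linarith) (by linarith)
  · intro p p' x y z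
    rw [hF, hF]
    exact h.1 _ _ (by linarith) (by linarith) (by linarith)

theorem noOpen {e : Mink ≃ Mink} (he : FH e) {v : Mink} (hv : 0 < qform v) {ε : ℝ} (hε : 0 < ε)
    (c : ℝ) {O : Set E3} (hO : IsOpen O) (hne : O.Nonempty)
    (h : ∀ b ∈ O, ∃ s, s ∈ Set.Icc c (c + ε / 2) ∧ IsV (Fl e v b) ε s) : False := by
  choose! τ hτ1 hτ2 using h
  have hinj : ∀ b, Function.Injective (Fl e v b) := fun b s s' h => (Fl_inj hv h).1
  have hτc : ContinuousOn τ O := by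
    refine continuous_of_closed (isClosed_isV he v ε) (K := Set.Icc c (c + ε / 2)) isCompact_Icc
      hτ1 hτ2 ?_
    intro b hb y hy hV
    have a1 := hτ1 b hb
    rcases lt_trichotomy y (τ b) with h | h | h
    · exact (isV_unique (hinj b) hV (hτ2 b hb) h (by linarith [hy.1, a1.2])).elim
    · exact h
    · exact (isV_unique (hinj b) (hτ2 b hb) hV h (by linarith [hy.2, a1.1])).elim
  obtain ⟨b0, hb0⟩ := hne
  obtain ⟨w, hw, δ, hδ, h6⟩ := L3 he (((0 : ℝ), b0) + τ b0 • v)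
  have hv1 := fst_ne_zero_of_qform_pos hv
  have hw1 := fst_ne_zero_of_qform_pos hw
  rcases lt_or_gt_of_ne (div_ne_zero hw1 hv1) with hκ | hκ
  · refine noOpen_aux he (v := -v) (by rwa [qform_neg]) hε hO (τ := fun b => -τ b) hτc.fun_neg
      (fun b hb => isV_neg (hτ2 b hb)) hb0 hw ?_ hδ ?_
    · simp only [Prod.fst_neg, div_neg]
      linarith
    · simpa only [smul_neg, neg_smul, neg_neg] using h6
  · exact noOpen_aux he hv hε hO hτc hτ2 hb0 hw hκ hδ h6
/-! ### Generic lines and monotonicity -/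

/-- Parameters `b` of lines with a turning point of size `ε` in `[c, c + ε/2]`. -/
def badSet (e : Mink ≃ Mink) (v : Mink) (ε c : ℝ) : Set E3 :=
  {b | ∃ s, s ∈ Set.Icc c (c + ε / 2) ∧ IsV (Fl e v b) ε s}

theorem isClosed_badSet {e : Mink ≃ Mink} (he : FH e) (v : Mink) (ε c : ℝ) :
    IsClosed (badSet e v ε c) := by
  have h1 : IsClosed {x : Set.Icc c (c + ε / 2) × E3 | IsV (Fl e v x.2) ε x.1} := by
    have := (isClosed_isV he v ε).preimage
      (show Continuous (fun x : Set.Icc c (c + ε / 2) × E3 => ((x.1 : ℝ), x.2)) by fun_prop)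
    exact this
  have h2 := isClosedMap_snd_of_compactSpace _ h1
  convert h2 using 1
  ext b
  constructor
  · rintro ⟨s, hs, hV⟩
    exact ⟨(⟨s, hs⟩, b), hV, rfl⟩
  · rintro ⟨⟨⟨s, hs⟩, b'⟩, hV, rfl⟩
    exact ⟨s, hs, hV⟩

theorem dense_badSet_compl {e : Mink ≃ Mink} (he : FH e) {v : Mink} (hv : 0 < qform v) {ε : ℝ}
    (hε : 0 < ε) (c : ℝ) : Dense (badSet e v ε c)ᶜ := by
  rw [← interior_eq_empty_iff_dense_compl]
  by_contra hne
  exact noOpen he hv hε c isOpen_interior (Set.nonempty_iff_ne_empty.2 hne)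
    (fun b hb => (interior_subset hb : b ∈ badSet e v ε c))

theorem isV_mono {γ : ℝ → Mink} {ε ε' s : ℝ} (h : IsV γ ε s) (hε : ε' ≤ ε) : IsV γ ε' s :=
  ⟨fun p p' x y z => h.1 p p' (by linarith) y z, fun p p' x y z => h.2 p p' x y (by linarith)⟩

theorem mem_badSet {e : Mink ≃ Mink} {v : Mink} {ε s : ℝ} (hε : 0 < ε) {b : E3}
    (h : IsV (Fl e v b) ε s) : ∃ (n : ℕ) (j : ℤ),
      b ∈ badSet e v (1 / ((n : ℝ) + 1)) (j * (1 / ((n : ℝ) + 1) / 2)) := by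
  obtain ⟨n, hn⟩ := exists_nat_one_div_lt hε
  set ε' := 1 / ((n : ℝ) + 1) with hε'
  have h0 : 0 < ε' / 2 := by positivity
  refine ⟨n, ⌊s / (ε' / 2)⌋, s, ⟨?_, ?_⟩, isV_mono h hn.le⟩
  · rw [← le_div_iff₀ h0]
    exact Int.floor_le _
  · have := (Int.lt_floor_add_one (s / (ε' / 2))).le
    rw [div_le_iff₀ h0] at this
    linarith

theorem Fl_theta (e : Mink ≃ Mink) (v : Mink) (b : E3) :
    Fl (e.trans thetaEquiv) v b = fun t => theta (Fl e v b t) := rfl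

theorem lines_dense {e : Mink ≃ Mink} (he : FH e) {v : Mink} (hv : 0 < qform v) :
    Dense {b | (∀ p p', p < p' → Chron (Fl e v b p) (Fl e v b p')) ∨
      (∀ p p', p < p' → Chron (Fl e v b p') (Fl e v b p))} := by
  have h2 : Dense (⋂ i : (ℕ × ℤ) × Bool, (badSet (if i.2 then e else e.trans thetaEquiv) v
      (1 / ((i.1.1 : ℝ) + 1)) (i.1.2 * (1 / ((i.1.1 : ℝ) + 1) / 2)))ᶜ) := by
    have hE : ∀ i : Bool, FH (if i then e else e.trans thetaEquiv) := by
      intro i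
      cases i
      · exact he.theta
      · exact he
    exact dense_iInter_of_isOpen (fun i => (isClosed_badSet (hE i.2) v _ _).isOpen_compl)
      (fun i => dense_badSet_compl (hE i.2) hv (by positivity) _)
  refine h2.mono ?_
  intro b hb
  simp only [Set.mem_iInter, Set.mem_compl_iff] at hb
  apply lemmaB (Fl_continuous he hv b) (Fl_right he hv b) (Fl_left he hv b)
  · intro s ε hε hV
    obtain ⟨n, j, hnj⟩ := mem_badSet hε hV
    exact hb ((n, j), true) hnj
  · intro s ε hε hV
    rw [← Fl_theta] at hV
    obtain ⟨n, j, hnj⟩ := mem_badSet hε hV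
    exact hb ((n, j), false) hnj

theorem lines_all {e : Mink ≃ Mink} (he : FH e) {v : Mink} (hv : 0 < qform v) (b : E3) :
    (∀ p p', p < p' → Chron (Fl e v b p) (Fl e v b p')) ∨
      (∀ p p', p < p' → Chron (Fl e v b p') (Fl e v b p)) := by
  have hcl : IsClosed ({b | ∀ p p', p < p' → Causal (Fl e v b p) (Fl e v b p')} ∪
      {b | ∀ p p', p < p' → Causal (Fl e v b p') (Fl e v b p)}) := by
    have hc := Fl_continuous_b he v
    simp only [Set.ofPred_forall]
    apply IsClosed.union
    · exact isClosed_iInter fun p => isClosed_iInter fun p' => isClosed_iInter fun _ =>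
        isClosed_causal (hc _) (hc _)
    · exact isClosed_iInter fun p => isClosed_iInter fun p' => isClosed_iInter fun _ =>
        isClosed_causal (hc _) (hc _)
  have hsub : {b | (∀ p p', p < p' → Chron (Fl e v b p) (Fl e v b p')) ∨
      (∀ p p', p < p' → Chron (Fl e v b p') (Fl e v b p))} ⊆
      ({b | ∀ p p', p < p' → Causal (Fl e v b p) (Fl e v b p')} ∪
      {b | ∀ p p', p < p' → Causal (Fl e v b p') (Fl e v b p)}) := by
    rintro b (h | h)
    · exact Or.inl fun p p' hp => (h p p' hp).causal
    · exact Or.inr fun p p' hp => (h p p' hp).causal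
  have hmem := hcl.closure_subset_iff.2 hsub (lines_dense he hv b)
  have hcont := Fl_continuous he hv b
  rcases hmem with h | h
  · left
    apply chron_of_GP hcont
    intro s
    rcases Fl_right he hv b s with h' | ⟨δ, hδ, h'⟩
    · exact h'
    · exact absurd (chron_causal (h' s (s + δ) le_rfl (by linarith) le_rfl)
        (h s (s + δ) (by linarith))) (chron_irrefl _)
  · right
    have := chron_of_GP (γ := fun t => theta (Fl e v b t)) (theta_continuous.comp hcont) (by
      intro s
      rw [GP_theta]
      rcases Fl_right he hv b s with ⟨δ, hδ, h'⟩ | h'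
      · exact absurd (chron_causal (h' s (s + δ) le_rfl (by linarith) le_rfl)
          (h s (s + δ) (by linarith))) (chron_irrefl _)
      · exact h')
    simpa only [chron_theta] using this

def SP (e : Mink ≃ Mink) (v : Mink) : Prop := ∀ (x : Mink) (r : ℝ), 0 < r → Chron (e x) (e (x + r • v))

def SM (e : Mink ≃ Mink) (v : Mink) : Prop := ∀ (x : Mink) (r : ℝ), 0 < r → Chron (e (x + r • v)) (e x)

theorem sign_v {e : Mink ≃ Mink} (he : FH e) {v : Mink} (hv : 0 < qform v) : SP e v ∨ SM e v := by
  have hv1 := fst_ne_zero_of_qform_pos hv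
  have hx : ∀ x : Mink, ∀ r : ℝ, e (x + r • v) =
      Fl e v (x.2 - (x.1 / v.1) • v.2) (x.1 / v.1 + r) := by
    intro x r
    unfold Fl
    congr 1
    ext1
    · simp; field_simp
    · simp only [Prod.snd_add, Prod.smul_snd]
      module
  have hx0 : ∀ x : Mink, e x = Fl e v (x.2 - (x.1 / v.1) • v.2) (x.1 / v.1) := by
    intro x
    have := hx x 0
    simpa using this
  have hc1 := Fl_continuous_b he v 1
  have hc0 := Fl_continuous_b he v 0
  rcases neg_const_sign (isPreconnected_univ (α := E3))
    (g := fun b => (Fl e v b 1).1 - (Fl e v b 0).1) (by fun_prop) (by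
      intro b _
      rcases lines_all he hv b with h | h
      · have := chron_fst (h 0 1 one_pos)
        linarith
      · have := chron_fst (h 0 1 one_pos)
        linarith) with h | h
  · left
    intro x r hr
    rw [hx, hx0 x]
    rcases lines_all he hv (x.2 - (x.1 / v.1) • v.2) with h' | h'
    · exact h' _ _ (by linarith)
    · have h1 := chron_fst (h' 0 1 one_pos)
      have h2 := h (x.2 - (x.1 / v.1) • v.2) trivial
      linarith
  · right
    intro x r hr
    rw [hx, hx0 x]
    rcases lines_all he hv (x.2 - (x.1 / v.1) • v.2) with h' | h'
    · have h1 := chron_fst (h' 0 1 one_pos)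
      have h2 := h (x.2 - (x.1 / v.1) • v.2) trivial
      linarith
    · exact h' _ _ (by linarith)

theorem same_sign {e : Mink ≃ Mink} (he : FH e) {v w : Mink} (hv : 0 < v.1) (hw : 0 < w.1)
    (h1 : SP e v) (h2 : SM e w) : False := by
  set κ := w.1 / v.1 with hκdef
  have hκ : 0 < κ := div_pos hw hv
  set d := w.2 - κ • v.2 with hd
  have hwv : w = κ • v + ((0 : ℝ), d) := by
    ext1
    · simp [hκdef, hv.ne']
    · simp [hd]
  have key : ∀ r : ℝ, 0 < r → Chron (e (0 + ((0 : ℝ), r • d))) (e 0) := by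
    intro r hr
    have a1 := h1 (0 + ((0 : ℝ), r • d)) (r * κ) (mul_pos hr hκ)
    have a2 := h2 0 r hr
    have e1 : 0 + ((0 : ℝ), r • d) + (r * κ) • v = 0 + r • w := by
      rw [hwv]
      ext1
      · simp; ring
      · simp only [Prod.snd_add, Prod.smul_snd]
        module
    rw [e1] at a1
    exact chron_causal a1 a2.causal
  have e0 : (0 : Mink) + ((0 : ℝ), (0 : E3)) = 0 := by
    have : ((0 : ℝ), (0 : E3)) = 0 := rfl
    rw [this, add_zero]
  by_cases hd0 : d = 0
  · have := key 1 one_pos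
    rw [hd0, smul_zero, e0] at this
    exact chron_irrefl _ this
  · have hdn := norm_pos_iff.2 hd0
    obtain ⟨δ, hδ, h3⟩ := L1 ((FCt_slice 0).comp he.1) (by
      intro b b' hbb
      have := e.injective hbb
      simpa using this)
    have hr0 : 0 < δ / (2 * ‖d‖) := by positivity
    have hn : ‖(δ / (2 * ‖d‖)) • d‖ = δ / 2 := by
      rw [norm_smul, Real.norm_eq_abs, abs_of_pos hr0]
      field_simp
    have a4 := h3 ((δ / (2 * ‖d‖)) • d) (by rw [hn]; linarith) (by rw [hn]; linarith)
    rw [e0] at a4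
    have a5 := (qform_pos_chron _ _).2 (Or.inr (key _ hr0))
    linarith

theorem order_dichotomy {e : Mink ≃ Mink} (he : FH e) :
    (∀ x y, Chron x y → Chron (e x) (e y)) ∨ (∀ x y, Chron x y → Chron (e y) (e x)) := by
  set v : Mink := ((1 : ℝ), (0 : E3)) with hv
  have hv0 : 0 < v.1 := by simp [hv]
  have hvq : 0 < qform v := by simp [hv, qform]
  have hxy : ∀ x y : Mink, Chron x y → 0 < qform (y - x) ∧ 0 < (y - x).1 := by
    intro x y h
    refine ⟨(qform_pos_chron _ _).2 (Or.inl h), ?_⟩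
    have := chron_fst h
    simp [this]
  rcases sign_v he hvq with h | h
  · left
    intro x y hc
    obtain ⟨h1, h2⟩ := hxy x y hc
    rcases sign_v he h1 with h' | h'
    · have := h' x 1 one_pos
      simpa using this
    · exact (same_sign he hv0 h2 h h').elim
  · right
    intro x y hc
    obtain ⟨h1, h2⟩ := hxy x y hc
    rcases sign_v he h1 with h' | h'
    · exact (same_sign he h2 hv0 h' h).elim
    · have := h' x 1 one_pos
      simpa using this
/-! ### Alexandrov-Zeeman: order isomorphisms are affine -/

def OI (f : Mink ≃ Mink) : Prop := ∀ x y, Chron (f x) (f y) ↔ Chron x y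

theorem OI.symm {f : Mink ≃ Mink} (hf : OI f) : OI f.symm := by
  intro x y
  have := hf (f.symm x) (f.symm y)
  simpa using this.symm

theorem causal_iff_chron (x y : Mink) : Causal x y ↔ ∀ z, Chron y z → Chron x z := by
  constructor
  · intro h z hz
    exact causal_chron h hz
  · intro h
    rw [causal_iff]
    apply le_of_forall_pos_lt_add
    intro η hη
    have := h (y + (η, (0 : E3))) (by
      rw [chron_iff]
      simpa using hη)
    rw [chron_iff] at this
    simp at this
    linarith

theorem OI.causal {f : Mink ≃ Mink} (hf : OI f) (x y : Mink) :
    Causal (f x) (f y) ↔ Causal x y := by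
  rw [causal_iff_chron, causal_iff_chron]
  constructor
  · intro h z hz
    exact (hf _ _).1 (h (f z) ((hf _ _).2 hz))
  · intro h z hz
    obtain ⟨z, rfl⟩ := f.surjective z
    exact (hf _ _).2 (h z ((hf _ _).1 hz))

theorem qform_zero_iff (x y : Mink) : qform (y - x) = 0 ↔
    (Causal x y ∨ Causal y x) ∧ ¬ (Chron x y ∨ Chron y x) := by
  rw [← qform_nonneg_causal, ← qform_pos_chron]
  constructor
  · intro h
    rw [h]
    simp
  · rintro ⟨h1, h2⟩
    linarith

theorem OI.null {f : Mink ≃ Mink} (hf : OI f) (x y : Mink) :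
    qform (f y - f x) = 0 ↔ qform (y - x) = 0 := by
  rw [qform_zero_iff, qform_zero_iff, hf.causal, hf.causal, hf, hf]

theorem par {a b : Mink} (ha : qform a = 0) (hb : qform b = 0) (hab : mink a b = 0) :
    b.1 • a = a.1 • b := by
  unfold qform at ha hb
  unfold mink at hab
  ext1
  · simp [mul_comm]
  · simp only [Prod.smul_snd]
    rw [← sub_eq_zero, ← norm_eq_zero, ← sq_eq_zero_iff, norm_sub_sq_real, norm_smul, norm_smul,
      real_inner_smul_left, real_inner_smul_right, mul_pow, mul_pow, Real.norm_eq_abs,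
      Real.norm_eq_abs, sq_abs, sq_abs]
    have h1 : ‖a.2‖ ^ 2 = a.1 ^ 2 := by linarith
    have h2 : ‖b.2‖ ^ 2 = b.1 ^ 2 := by linarith
    have h3 : inner ℝ a.2 b.2 = a.1 * b.1 := by linarith
    rw [h1, h2, h3]
    ring

theorem null_fst_ne {u : Mink} (hu : qform u = 0) (h0 : u ≠ 0) : u.1 ≠ 0 := by
  intro h
  apply h0
  unfold qform at hu
  rw [h] at hu
  have : ‖u.2‖ = 0 := by nlinarith [norm_nonneg u.2]
  exact Prod.ext h (norm_eq_zero.1 this)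

theorem OI.image_ne {f : Mink ≃ Mink} {x u : Mink} (h0 : u ≠ 0) : f (x + u) - f x ≠ 0 := by
  intro h
  have := f.injective (sub_eq_zero.1 h)
  simp at this
  exact h0 this

theorem OI.image_null {f : Mink ≃ Mink} (hf : OI f) {x u : Mink} (hu : qform u = 0) :
    qform (f (x + u) - f x) = 0 := by
  rw [hf.null, add_sub_cancel_left, hu]

theorem OI.line {f : Mink ≃ Mink} (hf : OI f) (x : Mink) {u : Mink} (hu : qform u = 0)
    (h0 : u ≠ 0) (r : ℝ) : ∃ ρ : ℝ, f (x + r • u) = f x + ρ • (f (x + u) - f x) := by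
  set n := f (x + u) - f x with hn
  have hnq : qform n = 0 := hf.image_null hu
  have hn1 : n.1 ≠ 0 := null_fst_ne hnq (OI.image_ne h0)
  set k := f (x + r • u) - f x with hk
  have hkq : qform k = 0 := hf.image_null (by rw [qform_smul, hu, mul_zero])
  have hkn : qform (k - n) = 0 := by
    have : k - n = f (x + r • u) - f (x + u) := by rw [hk, hn]; abel
    rw [this, hf.null]
    have : x + r • u - (x + u) = (r - 1) • u := by rw [sub_smul, one_smul]; abel
    rw [this, qform_smul, hu, mul_zero]
  rw [qform_sub, hkq, hnq] at hkn
  have hp := par hkq hnq (by linarith)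
  refine ⟨k.1 / n.1, ?_⟩
  have : k = (k.1 / n.1) • n := by
    rw [div_eq_inv_mul, mul_smul, ← hp, smul_smul, inv_mul_cancel₀ hn1, one_smul]
  rw [← this, hk]
  abel

theorem OI.line_onto {f : Mink ≃ Mink} (hf : OI f) (x : Mink) {u : Mink} (hu : qform u = 0)
    (h0 : u ≠ 0) (ρ : ℝ) : ∃ r : ℝ, f (x + r • u) = f x + ρ • (f (x + u) - f x) := by
  obtain ⟨r, hr⟩ := hf.symm.line (f x) (u := f (x + u) - f x) (hf.image_null hu)
    (OI.image_ne h0) ρ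
  refine ⟨r, ?_⟩
  rw [f.symm_apply_apply, add_sub_cancel, f.symm_apply_apply, add_sub_cancel_left] at hr
  rw [← hr, f.apply_symm_apply]

theorem norm_of_null {u : Mink} (hu : qform u = 0) (h1 : 0 < u.1) : ‖u.2‖ = u.1 := by
  unfold qform at hu
  have h : ‖u.2‖ ^ 2 = u.1 ^ 2 := by linarith
  exact (sq_eq_sq₀ (norm_nonneg _) h1.le).1 h

theorem null_past {u : Mink} (hu : qform u = 0) (h1 : 0 < u.1) (x p : Mink) :
    (∃ r : ℝ, Chron p (x + r • u)) ↔ 0 < mink (x - p) u := by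
  constructor
  · rintro ⟨r, hr⟩
    rw [chron_iff] at hr
    set z := x + r • u - p with hz
    have h2 : mink (x - p) u = mink z u := by
      have : z = x - p + r • u := by rw [hz]; abel
      rw [this, mink_add_left, mink_smul_left, mink_self, hu]
      ring
    have h3 : ‖z.2‖ < z.1 := hr
    rw [h2]
    unfold mink
    have h4 := real_inner_le_norm z.2 u.2
    rw [norm_of_null hu h1] at h4
    nlinarith
  · intro h
    set z := x - p with hz
    obtain ⟨r, hr⟩ := exists_nat_gt (max (-qform z / (2 * mink z u)) (-z.1 / u.1))
    rw [max_lt_iff, div_lt_iff₀ (by positivity), div_lt_iff₀ h1] at hr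
    refine ⟨r, ?_⟩
    have hq : 0 < qform (z + (r : ℝ) • u) := by
      rw [qform_add, mink_smul_right, qform_smul, hu]
      nlinarith [hr.1]
    have hf : 0 < (z + (r : ℝ) • u).1 := by
      simp only [Prod.fst_add, Prod.smul_fst, smul_eq_mul]
      linarith [hr.2]
    rw [qform_pos_iff, abs_of_pos hf] at hq
    have e1 : z + (r : ℝ) • u = x + (r : ℝ) • u - p := by rw [hz]; abel
    rw [e1] at hq
    exact hq

theorem OI.future {f : Mink ≃ Mink} (hf : OI f) {x u : Mink} (hu : qform u = 0) (h1 : 0 < u.1) :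
    0 < (f (x + u) - f x).1 := by
  have h0 : u ≠ 0 := by
    rintro rfl
    simp at h1
  have hne := null_fst_ne (hf.image_null (x := x) hu) (OI.image_ne h0)
  have hc : Causal x (x + u) := by
    rw [causal_iff]
    simp [norm_of_null hu h1]
  have hc := (hf.causal _ _).2 hc
  rw [causal_iff] at hc
  have := norm_nonneg ((f (x + u)).2 - (f x).2)
  apply lt_of_le_of_ne _ hne.symm
  simp only [Prod.fst_sub]
  linarith

theorem OI.past {f : Mink ≃ Mink} (hf : OI f) {u : Mink} (hu : qform u = 0) (h1 : 0 < u.1)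
    (x p : Mink) : 0 < mink (x - p) u ↔ 0 < mink (f x - f p) (f (x + u) - f x) := by
  have h0 : u ≠ 0 := by
    rintro rfl
    simp at h1
  rw [← null_past hu h1, ← null_past (hf.image_null hu) (hf.future hu h1)]
  constructor
  · rintro ⟨r, hr⟩
    obtain ⟨ρ, hρ⟩ := hf.line x hu h0 r
    refine ⟨ρ, ?_⟩
    rw [← hρ, hf]
    exact hr
  · rintro ⟨ρ, hρ⟩
    obtain ⟨r, hr⟩ := hf.line_onto x hu h0 ρ
    refine ⟨r, ?_⟩
    rw [← hr, hf] at hρ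
    exact hρ

theorem OI.parallel_aux {f : Mink ≃ Mink} (hf : OI f) {u : Mink} (hu : qform u = 0) (h1 : 0 < u.1)
    {x y : Mink} (hxy : mink x u ≤ mink y u) :
    mink (f (x + u) - f x) (f (y + u) - f y) = 0 := by
  set n := f (x + u) - f x with hn
  set m := f (y + u) - f y with hm
  have hnq : qform n = 0 := hf.image_null hu
  have hmq : qform m = 0 := hf.image_null hu
  by_contra hk
  set k := mink n m with hkdef
  obtain ⟨p, hp⟩ := f.surjective (f x + ((mink (f y - f x) m) / k) • n + (-1 / k) • m)
  have e1 : mink (f x - f p) n = 1 := by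
    have : f x - f p = -(((mink (f y - f x) m) / k) • n) - (-1 / k) • m := by rw [hp]; abel
    rw [this, mink_sub_left, ← neg_smul, mink_smul_left, mink_smul_left, mink_self, hnq,
      mink_comm m n, ← hkdef]
    field_simp
    ring
  have e2 : mink (f y - f p) m = 0 := by
    have : f y - f p = (f y - f x) - ((mink (f y - f x) m) / k) • n - (-1 / k) • m := by
      rw [hp]; abel
    rw [this, mink_sub_left, mink_sub_left (f y - f x), mink_smul_left, mink_smul_left, mink_self,
      hmq, ← hkdef]
    field_simp
    ring
  have h2 : 0 < mink (x - p) u := by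
    rw [hf.past hu h1, ← hn, e1]
    exact one_pos
  have h3 : 0 < mink (y - p) u := by
    rw [mink_sub_left] at h2 ⊢
    linarith
  rw [hf.past hu h1, ← hm, e2] at h3
  exact lt_irrefl _ h3

theorem OI.parallel {f : Mink ≃ Mink} (hf : OI f) {u : Mink} (hu : qform u = 0) (h1 : 0 < u.1)
    (x y : Mink) : ∃ c : ℝ, f (y + u) - f y = c • (f (x + u) - f x) := by
  have h : mink (f (x + u) - f x) (f (y + u) - f y) = 0 := by
    rcases le_total (mink x u) (mink y u) with h | h
    · exact hf.parallel_aux hu h1 h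
    · rw [mink_comm]
      exact hf.parallel_aux hu h1 h
  have hp := par (hf.image_null hu) (hf.image_null hu) h
  have hx := (hf.future (x := x) hu h1).ne'
  refine ⟨(f (y + u) - f y).1 / (f (x + u) - f x).1, ?_⟩
  rw [div_eq_inv_mul, mul_smul, hp, smul_smul, inv_mul_cancel₀ hx, one_smul]

theorem OI.pg {f : Mink ≃ Mink} (hf : OI f) {u v : Mink} (hu : qform u = 0) (hu1 : 0 < u.1)
    (hv : qform v = 0) (hv1 : 0 < v.1) (huv : mink u v ≠ 0) (x : Mink) :
    f (x + v + u) - f (x + v) = f (x + u) - f x := by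
  obtain ⟨c, hc⟩ := hf.parallel hu hu1 x (x + v)
  obtain ⟨c', hc'⟩ := hf.parallel hv hv1 x (x + u)
  have e1 : x + u + v = x + v + u := by abel
  rw [e1] at hc'
  set n := f (x + u) - f x with hn
  set m := f (x + v) - f x with hm
  have hnq : qform n = 0 := hf.image_null hu
  have hmq : qform m = 0 := hf.image_null hv
  have h1 : (c - 1) • n = (c' - 1) • m := by
    rw [sub_smul, sub_smul, ← hc, ← hc', one_smul, one_smul, hn, hm]
    abel
  have h2 := congrArg (fun z => mink z m) h1
  simp only [mink_smul_left, mink_self, hmq, mul_zero] at h2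
  have h3 : mink n m ≠ 0 := by
    intro h
    have h4 : qform (n - m) = 0 := by rw [qform_sub, hnq, hmq, h]; ring
    have e2 : n - m = f (x + u) - f (x + v) := by rw [hn, hm]; abel
    rw [e2, hf.null, add_sub_add_left_eq_sub, qform_sub, hu, hv] at h4
    apply huv
    linarith
  have h5 : c - 1 = 0 := by
    rcases mul_eq_zero.1 h2 with h | h
    · exact h
    · exact absurd h h3
  rw [hc]
  have : c = 1 := by linarith
  rw [this, one_smul]

theorem exists_unit (e : E3) : ∃ e' : E3, ‖e'‖ = 1 ∧ e' ≠ e ∧ -e' ≠ e := by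
  set a : E3 := EuclideanSpace.single 0 1 with ha
  set b : E3 := EuclideanSpace.single 1 1 with hb
  have a0 : a 0 = 1 := by simp [ha]
  have b0 : b 0 = 0 := by simp [hb]
  have na : ‖a‖ = 1 := by simp [ha]
  have nb : ‖b‖ = 1 := by simp [hb]
  by_cases h : a ≠ e ∧ -a ≠ e
  · exact ⟨a, na, h.1, h.2⟩
  · refine ⟨b, nb, ?_, ?_⟩
    · rintro rfl
      apply h
      constructor
      · intro h'
        rw [h', b0] at a0
        norm_num at a0
      · intro h'
        rw [← h'] at b0
        simp [a0] at b0
    · rintro rfl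
      apply h
      constructor
      · intro h'
        rw [h'] at a0
        simp [b0] at a0
      · intro h'
        rw [neg_inj.1 h', b0] at a0
        norm_num at a0

theorem generate (H : AddSubgroup Mink) (e : E3)
    (hH : ∀ v : Mink, 0 < v.1 → qform v = 0 → v.2 ≠ v.1 • e → v ∈ H) (w : Mink) : w ∈ H := by
  obtain ⟨e', he', h1, h2⟩ := exists_unit e
  have ht : ∀ t : ℝ, 0 < t → (t, (0 : E3)) ∈ H := by
    intro t ht
    have ht2 : t / 2 ≠ 0 := by linarith
    have a1 : (t / 2, (t / 2) • e') ∈ H := by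
      refine hH _ (by simpa using ht) ?_ ?_
      · simp [qform, norm_smul, he', abs_of_pos ht]
      · intro h
        exact h1 (smul_right_injective E3 ht2 h)
    have a2 : (t / 2, (t / 2) • (-e')) ∈ H := by
      refine hH _ (by simpa using ht) ?_ ?_
      · simp [qform, norm_smul, he', abs_of_pos ht]
      · intro h
        exact h2 (smul_right_injective E3 ht2 h)
    have a3 := H.add_mem a1 a2
    have : (t / 2, (t / 2) • e') + (t / 2, (t / 2) • (-e')) = (t, (0 : E3)) := by
      ext1
      · simp
      · simp
    rwa [this] at a3
  have ht' : ∀ t : ℝ, (t, (0 : E3)) ∈ H := by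
    intro t
    rcases lt_trichotomy t 0 with h | h | h
    · have := H.neg_mem (ht (-t) (by linarith))
      simpa using this
    · rw [h]
      exact H.zero_mem
    · exact ht t h
  have hy : ∀ y : E3, y ≠ ‖y‖ • e → ((0 : ℝ), y) ∈ H := by
    intro y hy
    have hy0 : 0 < ‖y‖ := by
      rw [norm_pos_iff]
      rintro rfl
      simp at hy
    have a1 : (‖y‖, y) ∈ H := hH _ hy0 (by simp [qform]) hy
    have := H.sub_mem a1 (ht' ‖y‖)
    simpa using this
  have hy' : ∀ y : E3, ((0 : ℝ), y) ∈ H := by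
    intro y
    by_cases h : y = ‖y‖ • e
    · by_cases h0 : y = 0
      · rw [h0]
        exact H.zero_mem
      · have := H.neg_mem (hy (-y) (by
          rw [norm_neg, ← h]
          intro h3
          apply h0
          rw [neg_eq_iff_add_eq_zero, ← two_smul ℝ] at h3
          simpa using h3))
        simpa using this
    · exact hy y h
  have := H.add_mem (ht' w.1) (hy' w.2)
  simpa using this

theorem OI.affine {f : Mink ≃ Mink} (hf : OI f) (x w : Mink) : f (x + w) = f x + (f w - f 0) := by
  have step1 : ∀ u : Mink, 0 < u.1 → qform u = 0 → ∀ w x,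
      f (x + w + u) - f (x + w) = f (x + u) - f x := by
    intro u hu1 hu w
    let G : AddSubgroup Mink :=
      { carrier := {w | ∀ x, f (x + w + u) - f (x + w) = f (x + u) - f x}
        zero_mem' := by
          intro x
          simp
        add_mem' := by
          intro a b ha hb x
          have h1 := hb (x + a)
          have h2 := ha x
          rw [← add_assoc, h1, h2]
        neg_mem' := by
          intro a ha x
          have h1 := ha (x + -a)
          rw [neg_add_cancel_right] at h1
          exact h1.symm }
    have : w ∈ G := by
      refine generate G (u.1⁻¹ • u.2) ?_ w
      intro v hv1 hv hne x
      refine hf.pg hu hu1 hv hv1 ?_ x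
      intro h
      apply hne
      have := par hu hv h
      have h2 := congrArg Prod.snd this
      simp only [Prod.smul_snd] at h2
      rw [smul_comm, h2, smul_smul, inv_mul_cancel₀ hu1.ne', one_smul]
    exact this
  let G : AddSubgroup Mink :=
    { carrier := {w | ∀ x, f (x + w) = f x + (f w - f 0)}
      zero_mem' := by
        intro x
        simp
      add_mem' := by
        intro a b ha hb x
        have h1 := hb (x + a)
        have h2 := ha x
        have h3 := hb a
        rw [← add_assoc, h1, h2, h3]
        abel
      neg_mem' := by
        intro a ha x
        have h1 := ha (x + -a)
        have h2 := ha (-a)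
        rw [neg_add_cancel_right] at h1
        rw [neg_add_cancel] at h2
        have h3 : f (-a) = f 0 - (f a - f 0) := eq_sub_of_add_eq h2.symm
        have h4 : f (x + -a) = f x - (f a - f 0) := eq_sub_of_add_eq h1.symm
        rw [h4, h3]
        abel }
  have : w ∈ G := by
    refine generate G 0 ?_ w
    intro v hv1 hv _ x
    have := step1 v hv1 hv x 0
    simp only [zero_add] at this
    rw [← this]
    abel
  exact this x

theorem OI.of_pres {e : Mink ≃ Mink} (he : FH e) (h : ∀ x y, Chron x y → Chron (e x) (e y)) :
    OI e := by
  intro x y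
  refine ⟨fun hxy => ?_, h x y⟩
  rcases order_dichotomy he.symm with h1 | h1
  · simpa using h1 _ _ hxy
  · exfalso
    have h0 : Chron (0 : Mink) ((1, 0) : Mink) := by simp [Chron, dtime, dspace]
    have h2 := h1 _ _ (h _ _ h0)
    simp [Chron, dtime, dspace] at h2
    linarith

theorem main_pres {e : Mink ≃ Mink} (he : FH e) (h : ∀ x y, Chron x y → Chron (e x) (e y)) :
    ∃ (lam : ℝ) (Λ : Mink →ₗ[ℝ] Mink) (a : Mink), 0 < lam ∧
        (∀ v, qform (Λ v) = qform v) ∧ ∀ x, e x = a + lam • Λ x := by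
  have hO := OI.of_pres he h
  have hadd : ∀ x y, (e (x + y) - e 0) = (e x - e 0) + (e y - e 0) := by
    intro x y
    rw [hO.affine x y]
    abel
  let A : Mink →+ Mink :=
    { toFun := fun x => e x - e 0
      map_zero' := by simp
      map_add' := hadd }
  have hA : ∀ x, A x = e x - e 0 := fun _ => rfl
  have htime : ∀ v : Mink, 0 < qform v → ∀ t : ℝ, A (t • v) = t • A v := by
    intro v hv t
    let B : ℝ →+ Mink := A.comp (AddMonoidHom.flip (smulAddHom ℝ Mink) v)
    have hB : ∀ t, B t = A (t • v) := fun _ => rfl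
    have hBc : Continuous B := by
      have h1 := ((FCt_line 0 v hv).comp he.1).continuous
      have h2 : (B : ℝ → Mink) = fun t => (e ∘ fun t : ℝ => 0 + t • v) t - e 0 := by
        funext t
        simp [hB, hA]
      rw [h2]
      exact h1.sub continuous_const
    have := map_real_smul B hBc t 1
    simpa [hB] using this
  have hsm : ∀ (t : ℝ) (w : Mink), A (t • w) = t • A w := by
    intro t w
    set N : ℝ := ‖w.2‖ + |w.1| + 1 with hN
    have hNp : 0 < N := by positivity
    have q1 : 0 < qform ((N, 0) : Mink) := by
      simp only [qform, norm_zero]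
      nlinarith
    have q2 : 0 < qform (w + ((N, 0) : Mink)) := by
      simp only [qform, Prod.fst_add, Prod.snd_add, add_zero]
      have := neg_abs_le w.1
      have := norm_nonneg w.2
      nlinarith
    have hw : w = (w + ((N, 0) : Mink)) - ((N, 0) : Mink) := by abel
    have h1 := htime _ q1 t
    have h2 := htime _ q2 t
    rw [hw, smul_sub, map_sub, map_sub, smul_sub, h1, h2]
  let L : Mink →ₗ[ℝ] Mink := { A with map_smul' := hsm }
  have hL : ∀ x, L x = e x - e 0 := fun _ => rfl
  have hnull : ∀ v : Mink, qform v = 0 → qform (L v) = 0 := by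
    intro v hv
    rw [hL]
    exact (hO.null 0 v).2 (by simpa using hv)
  set X : Mink := L ((1, 0) : Mink) with hX
  have hc : 0 < qform X := by
    rw [hX, hL, qform_pos_chron]
    left
    apply h
    simp [Chron, dtime, dspace]
  have hq : ∀ v, qform (L v) = qform X * qform v := by
    intro v
    set Y : Mink := L ((0, v.2) : Mink) with hY
    have hp : ∀ t : ℝ, L ((t, v.2) : Mink) = t • X + Y := by
      intro t
      rw [hX, hY, ← map_smul, ← map_add]
      simp
    have n1 : qform (‖v.2‖ • X + Y) = 0 := by
      rw [← hp]
      exact hnull _ (by simp [qform])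
    have n2 : qform ((-‖v.2‖) • X + Y) = 0 := by
      rw [← hp]
      exact hnull _ (by simp [qform])
    have e0 : L v = v.1 • X + Y := hp v.1
    rw [qform_add, qform_smul, mink_smul_left] at n1 n2
    have hXY : mink X Y = 0 := by
      by_cases h0 : v.2 = 0
      · have : Y = 0 := by
          rw [hY, h0]
          exact map_zero L
        rw [this]
        simp [mink]
      · have : ‖v.2‖ * mink X Y = 0 := by linarith
        rcases mul_eq_zero.1 this with h1 | h1
        · exact absurd (norm_eq_zero.1 h1) h0
        · exact h1
    rw [e0, qform_add, qform_smul, mink_smul_left, hXY]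
    have : qform v = v.1 ^ 2 - ‖v.2‖ ^ 2 := rfl
    rw [this]
    rw [hXY] at n1
    linarith
  refine ⟨√(qform X), (√(qform X))⁻¹ • L, e 0, Real.sqrt_pos.2 hc, ?_, ?_⟩
  · intro v
    rw [LinearMap.smul_apply, qform_smul, hq v, inv_pow, Real.sq_sqrt hc.le,
      inv_mul_cancel_left₀ hc.ne']
  · intro x
    rw [LinearMap.smul_apply, smul_inv_smul₀ (Real.sqrt_pos.2 hc).ne', hL]
    abel

theorem main_forward {e : Mink ≃ Mink} (he : FH e) :
    ∃ (lam : ℝ) (Λ : Mink →ₗ[ℝ] Mink) (a : Mink), 0 < lam ∧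
        (∀ v, qform (Λ v) = qform v) ∧ ∀ x, e x = a + lam • Λ x := by
  rcases order_dichotomy he with h | h
  · exact main_pres he h
  · obtain ⟨lam, Λ, a, hl, hΛ, hx⟩ := main_pres he.theta (fun x y hxy => by
      exact (chron_theta _ _).2 (h x y hxy))
    refine ⟨lam, thetaLin ∘ₗ Λ, theta a, hl, ?_, ?_⟩
    · intro v
      rw [LinearMap.comp_apply, thetaLin_apply, qform_theta, hΛ]
    · intro x
      have h1 : theta (e x) = a + lam • Λ x := hx x
      rw [← theta_theta (e x), h1, LinearMap.comp_apply, ← thetaLin_apply, ← thetaLin_apply,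
        map_add, map_smul]

/-- Zeeman's main theorem: a bijection of Minkowski space is a homeomorphism of the Fine
topology iff it is of the form `x ↦ a + λ • Λ x` with `λ > 0` and `Λ` a Lorentz
transformation, i.e. the homeomorphism group of `(M, F)` is generated by the Lorentz
group, translations and dilatations. -/
theorem fine_homeomorphism_iff_lorentz (f : Mink → Mink) (hf : Function.Bijective f) :
    (@Continuous Mink Mink Fine Fine f ∧ @IsOpenMap Mink Mink Fine Fine f) ↔
      ∃ (lam : ℝ) (Λ : Mink →ₗ[ℝ] Mink) (a : Mink), 0 < lam ∧
        (∀ v, qform (Λ v) = qform v) ∧ ∀ x, f x = a + lam • Λ x := by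
  constructor
  · rintro ⟨hc, ho⟩
    have he : FH (Equiv.ofBijective f hf) := by
      refine ⟨?_, ?_⟩
      · intro U hU
        rw [← fine_isOpen_iff] at hU ⊢
        exact (@continuous_def Mink Mink Fine Fine f).1 hc U hU
      · intro U hU
        rw [← fine_isOpen_iff] at hU ⊢
        have := ho U hU
        rwa [← Equiv.image_eq_preimage_symm]
    exact main_forward he
  · rintro ⟨lam, Λ, a, hl, hΛ, hx⟩
    have hfe : f = fun x => a + lam • Λ x := funext hx
    have hC : FC f := by
      rw [hfe]
      exact FC_affine a hl.ne' hΛ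
    refine ⟨(@continuous_def Mink Mink Fine Fine f).2 ?_, ?_⟩
    · intro U hU
      rw [fine_isOpen_iff] at hU ⊢
      exact hC U hU
    · intro U hU
      rw [fine_isOpen_iff] at hU ⊢
      let E := LinearEquiv.ofInjectiveEndo Λ (lorentz_injective hΛ)
      have hE : ∀ x, E x = Λ x := fun _ => rfl
      have hS : ∀ v, qform (E.symm.toLinearMap v) = qform v := by
        intro v
        rw [← hΛ, ← hE]
        simp
      have hC2 := FC_affine (-(lam⁻¹ • E.symm a)) (inv_ne_zero hl.ne') hS
      have himg : f '' U = (fun x => -(lam⁻¹ • E.symm a) + lam⁻¹ • E.symm.toLinearMap x) ⁻¹' U := by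
        refine congrFun (Set.image_eq_preimage_of_inverse ?_ ?_) U
        · intro x
          simp [hx, ← hE, hl.ne']
        · intro x
          rw [hx, ← hE]
          simp [hl.ne']
      rw [himg]
      exact hC2 U hU
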